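/- arXiv:2212.08521 — 2 statements merged into one kernel-verified Lean document; each statement's English description precedes it below -/
import Mathlib

section
/- There exists a holomorphic map φ : 𝔻 → ℂ² with bounded image which is an immersion (φ'(ζ) ≠ 0 for every ζ ∈ 𝔻, where φ' is the componentwise complex derivative) and is complete: for every divergent path γ : [0,1) → 𝔻 the path φ ∘ γ : [0,1) → ℂ² has infinite length. (Jones: existence of a complete bounded immersed complex disc in ℂ².) -/
open Set Metric
open scoped ENNReal

noncomputable section

/-- A path `γ : [0,1) → E` is a divergent path in the open set `Ω` if it is continuous on
`[0,1)`, takes values in `Ω`, and eventually leaves every compact subset of `Ω`. -/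
def DivergentPathIn {E : Type*} [TopologicalSpace E] (Ω : Set E) (γ : ℝ → E) : Prop :=
  ContinuousOn γ (Set.Ico 0 1) ∧
  (∀ t ∈ Set.Ico (0 : ℝ) 1, γ t ∈ Ω) ∧
  ∀ K : Set E, K ⊆ Ω → IsCompact K →
    ∃ t₀ ∈ Set.Ico (0 : ℝ) 1, ∀ t ∈ Set.Ico t₀ 1, γ t ∉ K

open Filter Topology

/-- Dependent choice: a step relation that preserves an invariant produces a sequence. -/
theorem exists_seq_of_step {α : Type*} {P : ℕ → α → Prop} {Q : ℕ → α → α → Prop} {a : α}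
    (h0 : P 0 a) (hstep : ∀ n x, P n x → ∃ y, P (n + 1) y ∧ Q n x y) :
    ∃ u : ℕ → α, ∀ n, P n (u n) ∧ Q n (u n) (u (n + 1)) := by
  choose! next hP hQ using hstep
  let u : ℕ → α := fun n => Nat.rec a next n
  have hu : ∀ n, P n (u n) := fun n => by
    induction n with
    | zero => exact h0
    | succ n ih => exact hP n _ ih
  exact ⟨u, fun n => ⟨hu n, hQ n _ (hu n)⟩⟩

/-- If `h` is locally dominated by `f` along `[a, b]`, the variation of `f` bounds the total
displacement of `h`. -/
theorem edist_le_eVariationOn_of_local {E F : Type*} [PseudoEMetricSpace E] [PseudoEMetricSpace F]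
    {f : ℝ → E} {h : ℝ → F} {a b : ℝ} (hab : a ≤ b)
    (H : ∀ t ∈ Icc a b, ∃ U ∈ 𝓝[Icc a b] t, ∀ x ∈ U, ∀ y ∈ U,
      edist (h x) (h y) ≤ edist (f x) (f y)) :
    edist (h a) (h b) ≤ eVariationOn f (Icc a b) := by
  have H' : ∀ t : Icc a b, ∃ V : Set (Icc a b), IsOpen V ∧ t ∈ V ∧ ∀ x ∈ V, ∀ y ∈ V,
      edist (h x) (h y) ≤ edist (f x) (f y) := by
    rintro ⟨t, ht⟩
    obtain ⟨U, hU, hUf⟩ := H t ht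
    obtain ⟨V, hVU, hV, htV⟩ := _root_.mem_nhds_iff.1 ((preimage_coe_mem_nhds_subtype (a := ⟨t, ht⟩)).2 hU)
    exact ⟨V, hV, htV, fun x hx y hy => hUf x (hVU hx) y (hVU hy)⟩
  choose V hVo hVt hVf using H'
  obtain ⟨t, ht0, htm, ⟨m, hm⟩, htc⟩ := exists_monotone_Icc_subset_open_cover_Icc hab hVo
    (fun t _ => mem_iUnion.2 ⟨t, hVt t⟩)
  calc edist (h a) (h b) = edist (h (t 0)) (h (t m)) := by rw [ht0, hm m le_rfl]
    _ ≤ ∑ i ∈ Finset.range m, edist (h (t i)) (h (t (i + 1))) :=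
      edist_le_range_sum_edist (fun i => h (t i)) m
    _ ≤ ∑ i ∈ Finset.range m, edist (f (t (i + 1))) (f (t i)) := by
      refine Finset.sum_le_sum fun i _ => ?_
      obtain ⟨j, hj⟩ := htc i
      rw [edist_comm (f _)]
      exact hVf j _ (hj ⟨le_rfl, htm (Nat.le_succ i)⟩) _ (hj ⟨htm (Nat.le_succ i), le_rfl⟩)
    _ ≤ eVariationOn f (Icc a b) :=
      eVariationOn.sum_le (f := f) (u := fun i => (t i : ℝ)) (fun i j hij => htm hij)
        (fun i => (t i).2)

/-- A map whose derivative at `z` has norm more than `c` expands distances near `z` by `c`. -/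
theorem HasStrictDerivAt.exists_nhds_mul_norm_sub_le {E : Type*} [NormedAddCommGroup E]
    [NormedSpace ℂ E] {φ : ℂ → E} {φ' : E} {z : ℂ} {c : ℝ} (h : HasStrictDerivAt φ φ' z)
    (hc : c < ‖φ'‖) :
    ∃ U ∈ 𝓝 z, ∀ x ∈ U, ∀ y ∈ U, c * ‖x - y‖ ≤ ‖φ x - φ y‖ := by
  have h1 := h.isLittleO.def (sub_pos.2 hc)
  rw [nhds_prod_eq] at h1
  obtain ⟨U, hU, hUs⟩ := Filter.eventually_prod_self_iff
    (r := fun x y => ‖φ x - φ y - (x - y) • φ'‖ ≤ (‖φ'‖ - c) * ‖x - y‖) |>.1 (by simpa using h1)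
  refine ⟨U, hU, fun x hx y hy => ?_⟩
  have h2 := hUs x hx y hy
  have h3 := norm_sub_norm_le ((x - y) • φ') ((x - y) • φ' - (φ x - φ y))
  rw [sub_sub_cancel, norm_smul, norm_sub_rev ((x - y) • φ')] at h3
  linarith

/-- If `‖φ'‖ > c` on the annulus `s ≤ ‖z‖ ≤ r`, a path crossing it is mapped to a path of length
at least `c (r - s)`. -/
theorem le_eVariationOn_comp_of_crossing {E : Type*} [NormedAddCommGroup E]
    [NormedSpace ℂ E] [CompleteSpace E] {φ : ℂ → E} {s r c a b : ℝ} {γ : ℝ → ℂ}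
    (hφ : DifferentiableOn ℂ φ (ball 0 1)) (hc : 0 ≤ c) (hsr : s ≤ r)
    (hφc : ∀ z ∈ ball (0 : ℂ) 1, s ≤ ‖z‖ → ‖z‖ ≤ r → c < ‖deriv φ z‖) (hab : a ≤ b)
    (hγ : ContinuousOn γ (Icc a b)) (hγb : ∀ t ∈ Icc a b, γ t ∈ ball (0 : ℂ) 1)
    (ha : ‖γ a‖ ≤ s) (hb : r ≤ ‖γ b‖) :
    ENNReal.ofReal (c * (r - s)) ≤ eVariationOn (fun t => φ (γ t)) (Icc a b) := by
  let k : ℂ → ℝ := fun z => c * max s (min r ‖z‖)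
  have hk : ∀ x y, |k x - k y| ≤ c * ‖x - y‖ := fun x y => by
    simp only [k]
    rw [← mul_sub, abs_mul, abs_of_nonneg hc]
    gcongr
    refine (abs_max_sub_max_le_max _ _ _ _).trans ?_
    rw [sub_self, abs_zero, max_eq_right (abs_nonneg _)]
    refine (abs_min_sub_min_le_max _ _ _ _).trans ?_
    rw [sub_self, abs_zero, max_eq_right (abs_nonneg _)]
    exact abs_norm_sub_norm_le x y
  have hloc : ∀ z ∈ ball (0 : ℂ) 1, ∃ U ∈ 𝓝 z, ∀ x ∈ U, ∀ y ∈ U,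
      |k x - k y| ≤ ‖φ x - φ y‖ := by
    intro z hz
    rcases lt_or_ge ‖z‖ s with h1 | h1
    · refine ⟨{x | ‖x‖ < s}, (isOpen_lt continuous_norm continuous_const).mem_nhds h1, ?_⟩
      intro x hx y hy
      have hx : ‖x‖ < s := hx
      have hy : ‖y‖ < s := hy
      have : k x = k y := by
        simp only [k]
        rw [max_eq_left ((min_le_right _ _).trans hx.le),
          max_eq_left ((min_le_right _ _).trans hy.le)]
      simp [this]
    rcases lt_or_ge r ‖z‖ with h2 | h2
    · refine ⟨{x | r < ‖x‖}, (isOpen_lt continuous_const continuous_norm).mem_nhds h2, ?_⟩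
      intro x hx y hy
      have hx : r < ‖x‖ := hx
      have hy : r < ‖y‖ := hy
      have : k x = k y := by
        simp only [k]
        rw [min_eq_left hx.le, min_eq_left hy.le]
      simp [this]
    obtain ⟨U, hU, hUφ⟩ := (hφ.analyticAt (isOpen_ball.mem_nhds hz)).hasStrictDerivAt
      |>.exists_nhds_mul_norm_sub_le (hφc z hz h1 h2)
    exact ⟨U, hU, fun x hx y hy => (hk x y).trans (hUφ x hx y hy)⟩
  have key := edist_le_eVariationOn_of_local (f := fun t => φ (γ t)) (h := fun t => k (γ t)) hab
    (fun t ht => by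
      obtain ⟨U, hU, hUφ⟩ := hloc _ (hγb t ht)
      refine ⟨_, hγ t ht hU, fun x hx y hy => ?_⟩
      rw [edist_dist, edist_dist, Real.dist_eq, dist_eq_norm]
      exact ENNReal.ofReal_le_ofReal (hUφ _ hx _ hy))
  refine le_trans (le_of_eq ?_) key
  have h1 : k (γ a) = c * s := by
    simp only [k]
    rw [max_eq_left ((min_le_right _ _).trans ha)]
  have h2 : k (γ b) = c * r := by
    simp only [k]
    rw [min_eq_left hb, max_eq_right hsr]
  rw [edist_comm, edist_dist, Real.dist_eq, h1, h2, ← mul_sub,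
    abs_of_nonneg (mul_nonneg hc (sub_nonneg.2 hsr))]

/-- Crossing infinitely many annuli with divergent total expansion forces infinite length. -/
theorem eVariationOn_comp_eq_top {E : Type*} [NormedAddCommGroup E]
    [NormedSpace ℂ E] [CompleteSpace E] {φ : ℂ → E} {r s c : ℕ → ℝ} {d : ℕ → ℝ} {γ : ℝ → ℂ}
    (hφ : DifferentiableOn ℂ φ (ball 0 1)) (hr : ∀ n, r n < 1)
    (hr1 : Tendsto r atTop (𝓝 1)) (hrs : ∀ n, r n ≤ s n) (hsr : ∀ n, s n ≤ r (n + 1))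
    (hc : ∀ n, 0 ≤ c n)
    (hφc : ∀ n, ∀ z ∈ ball (0 : ℂ) 1, s n ≤ ‖z‖ → ‖z‖ ≤ r (n + 1) → c n < ‖deriv φ z‖)
    (hd0 : ∀ n, 0 ≤ d n) (hcd : ∀ n, d n ≤ c n * (r (n + 1) - s n)) (hd : ¬ Summable d)
    (hγc : ContinuousOn γ (Ico 0 1)) (hγb : ∀ t ∈ Ico (0 : ℝ) 1, γ t ∈ ball (0 : ℂ) 1)
    (hγd : ∀ ρ < 1, ∃ t ∈ Ico (0 : ℝ) 1, ρ ≤ ‖γ t‖) :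
    eVariationOn (fun t => φ (γ t)) (Ico 0 1) = ⊤ := by
  have h0 : ‖γ 0‖ < 1 := by simpa using hγb 0 ⟨le_rfl, zero_lt_one⟩
  obtain ⟨m, hm⟩ := (hr1.eventually (lt_mem_nhds h0)).exists
  have key : ∀ n, ∀ t ∈ Ico (0 : ℝ) 1, r (n + m) ≤ ‖γ t‖ →
      ENNReal.ofReal (∑ k ∈ Finset.range n, d (k + m)) ≤
        eVariationOn (fun t => φ (γ t)) (Icc 0 t) := by
    intro n
    induction n with
    | zero => intro t _ _; simp
    | succ n ih =>
      intro t ht hrt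
      have hsub : Icc 0 t ⊆ Ico (0 : ℝ) 1 := fun x hx => ⟨hx.1, hx.2.trans_lt ht.2⟩
      have hmono : Monotone r := monotone_nat_of_le_succ fun n => (hrs n).trans (hsr n)
      have hrn : r (n + m) ∈ Icc ‖γ 0‖ ‖γ t‖ := by
        refine ⟨hm.le.trans (hmono (Nat.le_add_left _ _)), le_trans (hmono ?_) hrt⟩
        lia
      obtain ⟨t', ht', htr⟩ := intermediate_value_Icc ht.1 ((hγc.mono hsub).norm) hrn
      have hsub' : Icc t' t ⊆ Icc 0 t := Icc_subset_Icc_left ht'.1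
      have h1 := ih t' (hsub ht') (le_of_eq htr.symm)
      have h2 := le_eVariationOn_comp_of_crossing (γ := γ) hφ (hc (n + m))
        (hsr (n + m)) (hφc (n + m)) ht'.2 (hγc.mono (hsub'.trans hsub)) (fun x hx => hγb x (hsub (hsub' hx)))
        (le_trans (le_of_eq htr) (hrs _)) (by rwa [show n + m + 1 = n + 1 + m by lia])
      have h3 := eVariationOn.Icc_add_Icc (fun t => φ (γ t)) (s := univ) ht'.1 ht'.2 (mem_univ _)
      simp only [univ_inter] at h3
      rw [Finset.sum_range_succ, ENNReal.ofReal_add (Finset.sum_nonneg fun i _ => hd0 _) (hd0 _),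
        ← h3]
      exact add_le_add h1 ((ENNReal.ofReal_le_ofReal (hcd _)).trans h2)
  have htop : Tendsto (fun n => ∑ k ∈ Finset.range n, d (k + m)) atTop atTop :=
    (not_summable_iff_tendsto_nat_atTop_of_nonneg fun n => hd0 _).1
      (by rwa [summable_nat_add_iff (f := d) m])
  refine ENNReal.eq_top_of_forall_nnreal_le fun M => ?_
  obtain ⟨n, hn⟩ := (htop.eventually_ge_atTop (M : ℝ)).exists
  obtain ⟨t, ht, hrt⟩ := hγd _ (hr (n + m))
  calc (M : ℝ≥0∞) = ENNReal.ofReal M := by simp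
    _ ≤ _ := ENNReal.ofReal_le_ofReal hn
    _ ≤ _ := key n t ht hrt
    _ ≤ eVariationOn (fun t => φ (γ t)) (Ico 0 1) :=
      eVariationOn.mono _ fun x hx => ⟨hx.1, hx.2.trans_lt ht.2⟩

/-- The determinant of two vectors of `ℂ²`. -/
def wedge (u v : EuclideanSpace ℂ (Fin 2)) : ℂ := u 0 * v 1 - u 1 * v 0

theorem wedge_self (u : EuclideanSpace ℂ (Fin 2)) : wedge u u = 0 := by
  simp only [wedge]; ring

theorem norm_wedge_le (u v : EuclideanSpace ℂ (Fin 2)) : ‖wedge u v‖ ≤ 2 * ‖u‖ * ‖v‖ := by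
  have h : ∀ i j, ‖u i * v j‖ ≤ ‖u‖ * ‖v‖ := fun i j => by
    rw [norm_mul]
    gcongr
    exacts [PiLp.norm_apply_le u i, PiLp.norm_apply_le v j]
  unfold wedge
  linarith [norm_sub_le (u 0 * v 1) (u 1 * v 0), h 0 1, h 1 0]

theorem Continuous.wedge {X : Type*} [TopologicalSpace X] {u v : X → EuclideanSpace ℂ (Fin 2)}
    (hu : Continuous u) (hv : Continuous v) : Continuous fun x => wedge (u x) (v x) := by
  unfold _root_.wedge
  fun_prop

/-- Two entire maps to `ℂ²` that are orthogonal with the same constant norm `√R` on the unit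
circle, together with transversality conditions. -/
structure IsBalancedPair (R : ℝ) (F G : ℂ → EuclideanSpace ℂ (Fin 2)) : Prop where
  differentiable_left : Differentiable ℂ F
  differentiable_right : Differentiable ℂ G
  norm_left : ∀ z : ℂ, ‖z‖ = 1 → ‖F z‖ ^ 2 = R
  norm_right : ∀ z : ℂ, ‖z‖ = 1 → ‖G z‖ ^ 2 = R
  inner_eq_zero : ∀ z : ℂ, ‖z‖ = 1 → inner ℂ (F z) (G z) = 0
  wedge_ne_zero : ∀ z : ℂ, ‖z‖ = 1 → wedge (F z) (G z) ≠ 0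
  wedge_deriv_ne_zero : ∀ z : ℂ, ‖z‖ = 1 → wedge (deriv F z) (G z) ≠ 0
  deriv_ne_zero : ∀ z : ℂ, ‖z‖ ≤ 1 → deriv F z ≠ 0

/-- A strict lower bound on the unit circle persists on an annulus. -/
theorem exists_annulus_lt {h : ℂ → ℝ} (hh : Continuous h) {m : ℝ}
    (hm : ∀ z : ℂ, ‖z‖ = 1 → m < h z) :
    ∃ ρ < 1, ∀ z : ℂ, ρ ≤ ‖z‖ → ‖z‖ ≤ 1 → m < h z := by
  have hK : IsCompact (closedBall (0 : ℂ) 1 ∩ {z | h z ≤ m}) :=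
    (isCompact_closedBall 0 1).inter_right (isClosed_le hh continuous_const)
  rcases (closedBall (0 : ℂ) 1 ∩ {z | h z ≤ m}).eq_empty_or_nonempty with he | hne
  · refine ⟨0, one_pos, fun z _ hz => not_le.1 fun hle => ?_⟩
    exact eq_empty_iff_forall_notMem.1 he z ⟨by simpa using hz, hle⟩
  · obtain ⟨w, ⟨hw1, hwm⟩, hwmax⟩ := hK.exists_isMaxOn hne continuous_norm.continuousOn
    have hw : ‖w‖ < 1 := lt_of_le_of_ne (by simpa using hw1) fun h1 =>
      (hm w h1).not_ge hwm
    refine ⟨(‖w‖ + 1) / 2, by linarith, fun z hz hz1 => not_le.1 fun hle => ?_⟩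
    have : ‖z‖ ≤ ‖w‖ := hwmax ⟨by simpa using hz1, hle⟩
    linarith

theorem exists_pos_forall_le_of_isCompact {K : Set ℂ} (hK : IsCompact K) {h : ℂ → ℝ}
    (hh : Continuous h) (hpos : ∀ z ∈ K, 0 < h z) : ∃ m > 0, ∀ z ∈ K, m ≤ h z := by
  rcases K.eq_empty_or_nonempty with rfl | hne
  · exact ⟨1, one_pos, by simp⟩
  · obtain ⟨w, hw, hmin⟩ := hK.exists_isMinOn hne hh.continuousOn
    exact ⟨h w, hpos w hw, fun z hz => hmin hz⟩

theorem exists_forall_closedBall_norm_le {F : ℂ → EuclideanSpace ℂ (Fin 2)} (hF : Continuous F) :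
    ∃ K > 0, ∀ z : ℂ, ‖z‖ ≤ 1 → ‖F z‖ ≤ K := by
  obtain ⟨K, hK⟩ := (isCompact_closedBall (0 : ℂ) 1).exists_bound_of_continuousOn hF.continuousOn
  exact ⟨max K 1, by positivity, fun z hz => (hK z (by simpa using hz)).trans (le_max_left _ _)⟩

/-- The first component of the Rudin-Shapiro type modification of a pair of maps. -/
def stepLeft (δ : ℝ) (k : ℕ) (F G : ℂ → EuclideanSpace ℂ (Fin 2)) (z : ℂ) :
    EuclideanSpace ℂ (Fin 2) := F z + ((δ : ℂ) * z ^ (k + 1)) • G z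

/-- The second component of the Rudin-Shapiro type modification of a pair of maps. -/
def stepRight (δ : ℝ) (k : ℕ) (F G : ℂ → EuclideanSpace ℂ (Fin 2)) (z : ℂ) :
    EuclideanSpace ℂ (Fin 2) := (-(δ : ℂ)) • F z + (z ^ (k + 1)) • G z

/-- The map whose product with `z ^ k` is the derivative of `z ^ (k + 1) • G`. -/
def powDeriv (k : ℕ) (G : ℂ → EuclideanSpace ℂ (Fin 2)) (z : ℂ) : EuclideanSpace ℂ (Fin 2) :=
  ((k : ℂ) + 1) • G z + z • deriv G z

theorem norm_natCast_add_one (k : ℕ) : ‖(k : ℂ) + 1‖ = (k : ℝ) + 1 := by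
  rw [← Nat.cast_succ, Complex.norm_natCast, Nat.cast_succ]

namespace IsBalancedPair

variable {R : ℝ} {F G : ℂ → EuclideanSpace ℂ (Fin 2)}

theorem continuous_deriv_left (h : IsBalancedPair R F G) : Continuous (deriv F) :=
  (h.differentiable_left.contDiff (n := 1)).continuous_deriv le_rfl

theorem continuous_deriv_right (h : IsBalancedPair R F G) : Continuous (deriv G) :=
  (h.differentiable_right.contDiff (n := 1)).continuous_deriv le_rfl

theorem norm_add_smul_sq (h : IsBalancedPair R F G) {z : ℂ} (hz : ‖z‖ = 1) (a b : ℂ) :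
    ‖a • F z + b • G z‖ ^ 2 = (‖a‖ ^ 2 + ‖b‖ ^ 2) * R := by
  rw [norm_add_sq (𝕜 := ℂ), inner_smul_left, inner_smul_right, h.inner_eq_zero z hz, norm_smul,
    norm_smul, mul_pow, mul_pow, h.norm_left z hz, h.norm_right z hz]
  simp
  ring

theorem inner_add_smul (h : IsBalancedPair R F G) {z : ℂ} (hz : ‖z‖ = 1) (a b c d : ℂ) :
    inner ℂ (a • F z + b • G z) (c • F z + d • G z) =
      (starRingEnd ℂ a * c + starRingEnd ℂ b * d) * (R : ℂ) := by
  have h1 := h.inner_eq_zero z hz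
  have h2 := inner_eq_zero_symm.1 h1
  have h3 : inner ℂ (F z) (F z) = (R : ℂ) := by
    rw [inner_self_eq_norm_sq_to_K, ← h.norm_left z hz]; simp
  have h4 : inner ℂ (G z) (G z) = (R : ℂ) := by
    rw [inner_self_eq_norm_sq_to_K, ← h.norm_right z hz]; simp
  simp only [inner_add_left, inner_add_right, inner_smul_left, inner_smul_right, h1, h2, h3, h4]
  ring

theorem hasDerivAt_stepLeft (h : IsBalancedPair R F G) (δ : ℝ) (k : ℕ) (z : ℂ) :
    HasDerivAt (stepLeft δ k F G) (deriv F z + ((δ : ℂ) * z ^ k) • powDeriv k G z) z := by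
  have h1 := (h.differentiable_left z).hasDerivAt
  have h2 := (h.differentiable_right z).hasDerivAt
  have h3 := (((hasDerivAt_pow (k + 1) z).const_mul (δ : ℂ)).smul h2)
  convert! h1.add h3 using 1
  simp only [powDeriv, smul_add, smul_smul]
  rw [add_comm (_ • deriv G z)]
  push_cast
  congr 3 <;> ring

theorem wedge_deriv_step_ne_zero (h : IsBalancedPair R F G) {δ K : ℝ} (hδ : 0 < δ) (hδ1 : δ ≤ 1)
    {k : ℕ} {z : ℂ} (hz : ‖z‖ = 1) (hFK : ‖F z‖ ≤ K) (hGK : ‖G z‖ ≤ K) (hF'K : ‖deriv F z‖ ≤ K)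
    (hG'K : ‖deriv G z‖ ≤ K)
    (hk : 8 * K ^ 2 < δ ^ 2 * ((k : ℝ) + 1) * ‖wedge (F z) (G z)‖) :
    wedge (deriv (stepLeft δ k F G) z) (stepRight δ k F G z) ≠ 0 := by
  intro h0
  have hδn : ‖(δ : ℂ)‖ = δ := by rw [Complex.norm_real, Real.norm_of_nonneg hδ.le]
  have hw : ∀ u v : EuclideanSpace ℂ (Fin 2), ‖u‖ ≤ K → ‖v‖ ≤ K → ‖wedge u v‖ ≤ 2 * K ^ 2 := by
    intro u v hu hv
    have := norm_wedge_le u v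
    nlinarith [mul_le_mul hu hv (norm_nonneg v) ((norm_nonneg u).trans hu)]
  have hw1 := hw _ _ hF'K hGK
  have hw2 := hw _ _ hF'K hFK
  have hw3 := hw _ _ hG'K hGK
  have hw4 := hw _ _ hG'K hFK
  rw [(h.hasDerivAt_stepLeft δ k z).deriv] at h0
  have h1 : wedge (deriv F z + ((δ : ℂ) * z ^ k) • powDeriv k G z) (stepRight δ k F G z) =
      z ^ (k + 1) * wedge (deriv F z) (G z) - δ * wedge (deriv F z) (F z)
      + δ * z ^ k * z * z ^ (k + 1) * wedge (deriv G z) (G z)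
      - δ ^ 2 * z ^ k * z * wedge (deriv G z) (F z)
      + (δ : ℂ) ^ 2 * z ^ k * ((k : ℂ) + 1) * wedge (F z) (G z) := by
    simp only [wedge, powDeriv, stepRight, PiLp.add_apply, PiLp.smul_apply, smul_eq_mul]
    ring
  have hexp : (δ : ℂ) ^ 2 * z ^ k * ((k : ℂ) + 1) * wedge (F z) (G z) =
      -(z ^ (k + 1) * wedge (deriv F z) (G z)) + δ * wedge (deriv F z) (F z)
      - δ * z ^ k * z * z ^ (k + 1) * wedge (deriv G z) (G z)
      + δ ^ 2 * z ^ k * z * wedge (deriv G z) (F z) := by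
    rw [h1] at h0
    linear_combination h0
  have hle : ‖(δ : ℂ) ^ 2 * z ^ k * ((k : ℂ) + 1) * wedge (F z) (G z)‖ ≤
      2 * K ^ 2 + 2 * K ^ 2 + 2 * K ^ 2 + 2 * K ^ 2 := by
    rw [hexp]
    have hδ2 : δ ^ 2 ≤ 1 := pow_le_one₀ hδ.le hδ1
    have hc : ∀ a w : ℂ, ‖a‖ ≤ 1 → ‖w‖ ≤ 2 * K ^ 2 → ‖a * w‖ ≤ 2 * K ^ 2 := fun a w ha hw => by
      rw [norm_mul]
      exact (mul_le_of_le_one_left (norm_nonneg w) ha).trans hw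
    refine (norm_add_le _ _).trans (add_le_add ((norm_sub_le _ _).trans (add_le_add
      ((norm_add_le _ _).trans (add_le_add ?_ (hc _ _ ?_ hw2))) (hc _ _ ?_ hw3)))
      (hc _ _ ?_ hw4))
    · rw [norm_neg]
      exact hc _ _ (by simp [hz]) hw1
    · rwa [hδn]
    · simp only [norm_mul, norm_pow, hz, hδn, one_pow, mul_one, hδ1]
    · simp only [norm_mul, norm_pow, hz, hδn, one_pow, mul_one, hδ2]
  simp only [norm_mul, norm_pow, hz, hδn, norm_natCast_add_one, one_pow, mul_one] at hle
  linarith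

theorem deriv_stepLeft_ne_zero (h : IsBalancedPair R F G) {δ K : ℝ} {k : ℕ} {z : ℂ}
    (hz : ‖z‖ ≤ 1) (hF'K : ‖deriv F z‖ ≤ K) (hG'K : ‖deriv G z‖ ≤ K)
    (hk : 2 * K ^ 2 < ((k : ℝ) + 1) * ‖wedge (deriv F z) (G z)‖) :
    deriv (stepLeft δ k F G) z ≠ 0 := by
  intro h0
  have hw1 := norm_wedge_le (deriv F z) (deriv G z)
  have hw2 := mul_le_mul hF'K hG'K (norm_nonneg _) ((norm_nonneg _).trans hF'K)
  have h1 : wedge (deriv (stepLeft δ k F G) z) (powDeriv k G z) =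
      ((k : ℂ) + 1) * wedge (deriv F z) (G z) + z * wedge (deriv F z) (deriv G z) := by
    rw [(h.hasDerivAt_stepLeft δ k z).deriv]
    simp only [wedge, powDeriv, PiLp.add_apply, PiLp.smul_apply, smul_eq_mul]
    ring
  have h2 : ((k : ℂ) + 1) * wedge (deriv F z) (G z) = -(z * wedge (deriv F z) (deriv G z)) := by
    rw [h0] at h1
    simp only [wedge, PiLp.zero_apply, zero_mul, sub_zero] at h1 ⊢
    linear_combination -h1
  have h3 := congrArg norm h2
  rw [norm_neg, norm_mul, norm_mul, norm_natCast_add_one] at h3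
  have h4 := mul_le_of_le_one_left (norm_nonneg (wedge (deriv F z) (deriv G z))) hz
  nlinarith

theorem isBalancedPair_step (h : IsBalancedPair R F G) (δ : ℝ) (k : ℕ)
    (hw : ∀ z : ℂ, ‖z‖ = 1 → wedge (deriv (stepLeft δ k F G) z) (stepRight δ k F G z) ≠ 0)
    (hd : ∀ z : ℂ, ‖z‖ ≤ 1 → deriv (stepLeft δ k F G) z ≠ 0) :
    IsBalancedPair ((1 + δ ^ 2) * R) (stepLeft δ k F G) (stepRight δ k F G) where
  differentiable_left z := (h.hasDerivAt_stepLeft δ k z).differentiableAt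
  differentiable_right := by
    have := h.differentiable_left
    have := h.differentiable_right
    unfold stepRight
    fun_prop
  norm_left z hz := by
    simpa [stepLeft, hz] using h.norm_add_smul_sq hz 1 (δ * z ^ (k + 1))
  norm_right z hz := by
    have := h.norm_add_smul_sq hz (-δ) (z ^ (k + 1))
    rw [stepRight, this]
    simp [hz, add_comm]
  inner_eq_zero z hz := by
    have h1 := h.inner_add_smul hz 1 (δ * z ^ (k + 1)) (-δ) (z ^ (k + 1))
    have h2 : starRingEnd ℂ z * z = 1 := by
      rw [mul_comm, Complex.mul_conj, Complex.normSq_eq_norm_sq, hz]; simp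
    rw [map_mul, map_pow, mul_assoc, ← mul_pow, h2, one_smul] at h1
    rw [stepLeft, stepRight, h1]
    simp
  wedge_ne_zero z hz := by
    have h1 : wedge (stepLeft δ k F G z) (stepRight δ k F G z) =
        (1 + (δ : ℂ) ^ 2) * z ^ (k + 1) * wedge (F z) (G z) := by
      simp only [wedge, stepLeft, stepRight, PiLp.add_apply, PiLp.smul_apply, smul_eq_mul]
      ring
    rw [h1]
    have hz0 : z ≠ 0 := by rintro rfl; simp at hz
    refine mul_ne_zero (mul_ne_zero ?_ (pow_ne_zero _ hz0)) (h.wedge_ne_zero z hz)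
    exact_mod_cast (by positivity : (1 + δ ^ 2) ≠ 0)
  wedge_deriv_ne_zero := hw
  deriv_ne_zero := hd

theorem norm_stepLeft_sub_le (h : IsBalancedPair R F G) {δ K ρ : ℝ} (hδ : 0 ≤ δ) (hδ1 : δ ≤ 1)
    {k : ℕ} {z : ℂ} (hρ1 : ρ ≤ 1) (hz : ‖z‖ ≤ ρ) (hGK : ‖G z‖ ≤ K) (hG'K : ‖deriv G z‖ ≤ K) :
    ‖stepLeft δ k F G z - F z‖ ≤ ((k : ℝ) + 2) * ρ ^ k * K ∧
      ‖deriv (stepLeft δ k F G) z - deriv F z‖ ≤ ((k : ℝ) + 2) * ρ ^ k * K := by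
  have hδn : ‖(δ : ℂ)‖ = δ := by rw [Complex.norm_real, Real.norm_of_nonneg hδ]
  have hρ0 : 0 ≤ ρ := (norm_nonneg z).trans hz
  have hK : 0 ≤ K := (norm_nonneg _).trans hGK
  have hz1 : ‖z‖ ≤ 1 := hz.trans hρ1
  have hpow : ‖z‖ ^ k ≤ ρ ^ k := by gcongr
  have hA : ‖powDeriv k G z‖ ≤ ((k : ℝ) + 2) * K := by
    calc ‖powDeriv k G z‖ ≤ ((k : ℝ) + 1) * ‖G z‖ + ‖z‖ * ‖deriv G z‖ := by
          refine (norm_add_le _ _).trans ?_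
          rw [norm_smul, norm_smul, norm_natCast_add_one]
      _ ≤ ((k : ℝ) + 1) * K + 1 * K := by gcongr
      _ = _ := by ring
  constructor
  · rw [stepLeft, add_sub_cancel_left, norm_smul, norm_mul, norm_pow, hδn, pow_succ]
    calc δ * (‖z‖ ^ k * ‖z‖) * ‖G z‖ ≤ 1 * (ρ ^ k * 1) * K := by gcongr
      _ ≤ ((k : ℝ) + 2) * ρ ^ k * K := by
        rw [one_mul, mul_one]
        gcongr
        have : 0 ≤ ρ ^ k := by positivity
        nlinarith
  · rw [(h.hasDerivAt_stepLeft δ k z).deriv, add_sub_cancel_left, norm_smul, norm_mul, norm_pow,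
      hδn]
    calc δ * ‖z‖ ^ k * ‖powDeriv k G z‖ ≤ 1 * ρ ^ k * (((k : ℝ) + 2) * K) := by gcongr
      _ = _ := by ring

theorem le_norm_deriv_stepLeft (h : IsBalancedPair R F G) {δ K : ℝ} (hδ : 0 < δ) (hδ1 : δ ≤ 1)
    {k : ℕ} {z : ℂ} (hz : 1 - 1 / (2 * ((k : ℝ) + 1)) ≤ ‖z‖) (hz1 : ‖z‖ ≤ 1)
    (hF'K : ‖deriv F z‖ ≤ K) (hG'K : ‖deriv G z‖ ≤ K) (hG : 1 / 2 ≤ ‖G z‖)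
    (hkK : 16 * K ≤ ((k : ℝ) + 1) * δ) :
    δ * ((k : ℝ) + 1) / 8 ≤ ‖deriv (stepLeft δ k F G) z‖ := by
  have hδn : ‖(δ : ℂ)‖ = δ := by rw [Complex.norm_real, Real.norm_of_nonneg hδ.le]
  have hK : 0 ≤ K := (norm_nonneg _).trans hF'K
  have hle : 1 / (2 * ((k : ℝ) + 1)) ≤ 1 := by
    rw [div_le_one (by positivity)]
    linarith [(Nat.cast_nonneg k : (0 : ℝ) ≤ k)]
  have hpow : 1 / 2 ≤ ‖z‖ ^ k := by
    have h1 := one_add_mul_le_pow (a := -(1 / (2 * ((k : ℝ) + 1)))) (by linarith) (k + 1)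
    calc (1 : ℝ) / 2 = 1 + ((k + 1 : ℕ) : ℝ) * -(1 / (2 * ((k : ℝ) + 1))) := by
          push_cast; field_simp; norm_num
      _ ≤ _ := h1
      _ = (1 - 1 / (2 * ((k : ℝ) + 1))) ^ (k + 1) := by rw [sub_eq_add_neg]
      _ ≤ ‖z‖ ^ (k + 1) := pow_le_pow_left₀ (by linarith) hz _
      _ ≤ ‖z‖ ^ k := pow_le_pow_of_le_one (norm_nonneg _) hz1 (Nat.le_succ k)
  have hA : ((k : ℝ) + 1) / 2 - K ≤ ‖powDeriv k G z‖ := by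
    have h1 : ‖((k : ℂ) + 1) • G z‖ ≤ ‖powDeriv k G z‖ + ‖z • deriv G z‖ := by
      have := norm_sub_le (powDeriv k G z) (z • deriv G z)
      rwa [powDeriv, add_sub_cancel_right] at this
    rw [norm_smul, norm_smul, norm_natCast_add_one] at h1
    have h2 : ‖z‖ * ‖deriv G z‖ ≤ 1 * K := by gcongr
    nlinarith
  have h1 : ‖((δ : ℂ) * z ^ k) • powDeriv k G z‖ ≤
      ‖deriv (stepLeft δ k F G) z‖ + ‖deriv F z‖ := by
    have := norm_sub_le (deriv (stepLeft δ k F G) z) (deriv F z)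
    rw [(h.hasDerivAt_stepLeft δ k z).deriv] at this ⊢
    rwa [add_sub_cancel_left] at this
  rw [norm_smul, norm_mul, norm_pow, hδn] at h1
  have h2 : δ * (1 / 2) * (((k : ℝ) + 1) / 2 - K) ≤ δ * ‖z‖ ^ k * ‖powDeriv k G z‖ := by
    have : 0 ≤ ((k : ℝ) + 1) / 2 - K := by nlinarith
    gcongr
  nlinarith

/-- A balanced pair has a small modification, close to it on a given disc, whose first component
has large derivative on an annulus near the unit circle. -/
theorem exists_step (h : IsBalancedPair R F G) {δ : ℝ} (hδ : 0 < δ) (hδ1 : δ ≤ 1)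
    (hR : 1 ≤ R) {ε ρ₀ : ℝ} (hε : 0 < ε) (hρ₀ : ρ₀ < 1) :
    ∃ (r s L : ℝ) (F' G' : ℂ → EuclideanSpace ℂ (Fin 2)),
      IsBalancedPair ((1 + δ ^ 2) * R) F' G' ∧ ρ₀ ≤ s ∧ s < r ∧ r < 1 ∧ 0 < L ∧
      (∀ z : ℂ, ‖z‖ ≤ ρ₀ → ‖F' z - F z‖ ≤ ε ∧ ‖deriv F' z - deriv F z‖ ≤ ε) ∧
      δ / 32 ≤ L * (r - s) ∧ ∀ z : ℂ, s ≤ ‖z‖ → ‖z‖ ≤ r → L ≤ ‖deriv F' z‖ := by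
  have hFc := h.differentiable_left.continuous
  have hGc := h.differentiable_right.continuous
  have hF'c := h.continuous_deriv_left
  have hG'c := h.continuous_deriv_right
  -- bounds on the closed disc and on the circle
  obtain ⟨K, hK, hKb⟩ : ∃ K > 0, ∀ z : ℂ, ‖z‖ ≤ 1 →
      ‖F z‖ ≤ K ∧ ‖G z‖ ≤ K ∧ ‖deriv F z‖ ≤ K ∧ ‖deriv G z‖ ≤ K := by
    obtain ⟨K₁, h₁, hK₁⟩ := exists_forall_closedBall_norm_le hFc
    obtain ⟨K₂, h₂, hK₂⟩ := exists_forall_closedBall_norm_le hGc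
    obtain ⟨K₃, h₃, hK₃⟩ := exists_forall_closedBall_norm_le hF'c
    obtain ⟨K₄, h₄, hK₄⟩ := exists_forall_closedBall_norm_le hG'c
    refine ⟨K₁ + K₂ + K₃ + K₄, by positivity, fun z hz => ⟨?_, ?_, ?_, ?_⟩⟩
    · linarith [hK₁ z hz]
    · linarith [hK₂ z hz]
    · linarith [hK₃ z hz]
    · linarith [hK₄ z hz]
  obtain ⟨μ, hμ, hμb⟩ := exists_pos_forall_le_of_isCompact (isCompact_closedBall (0 : ℂ) 1)
    hF'c.norm (fun z hz => norm_pos_iff.2 (h.deriv_ne_zero z (by simpa using hz)))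
  obtain ⟨m, hm, hmb⟩ := exists_pos_forall_le_of_isCompact (isCompact_sphere (0 : ℂ) 1)
    (hF'c.wedge hGc).norm
    (fun z hz => norm_pos_iff.2 (h.wedge_deriv_ne_zero z (by simpa using hz)))
  obtain ⟨p, hp, hpb⟩ := exists_pos_forall_le_of_isCompact (isCompact_sphere (0 : ℂ) 1)
    (hFc.wedge hGc).norm
    (fun z hz => norm_pos_iff.2 (h.wedge_ne_zero z (by simpa using hz)))
  -- an annulus along the circle
  obtain ⟨ρ, hρ0, hρ1, hρ₀ρ, hρm, hρG⟩ : ∃ ρ : ℝ, 0 ≤ ρ ∧ ρ < 1 ∧ ρ₀ ≤ ρ ∧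
      (∀ z : ℂ, ρ ≤ ‖z‖ → ‖z‖ ≤ 1 → m / 2 < ‖wedge (deriv F z) (G z)‖) ∧
      (∀ z : ℂ, ρ ≤ ‖z‖ → ‖z‖ ≤ 1 → 1 / 2 < ‖G z‖) := by
    obtain ⟨ρ₁, h₁, hρ₁⟩ := exists_annulus_lt (hF'c.wedge hGc).norm (m := m / 2) fun z hz =>
      (half_lt_self hm).trans_le (hmb z (by simpa using hz))
    obtain ⟨ρ₂, h₂, hρ₂⟩ := exists_annulus_lt hGc.norm (m := 1 / 2) fun z hz => by
      have := h.norm_right z hz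
      nlinarith [norm_nonneg (G z)]
    refine ⟨max (max 0 ρ₀) (max ρ₁ ρ₂), by simp, by simp [*], by simp,
      fun z hz => hρ₁ z ?_, fun z hz => hρ₂ z ?_⟩
    · exact le_trans (by simp) hz
    · exact le_trans (by simp) hz
  -- a large exponent
  have hlin : Tendsto (fun k : ℕ => (k : ℝ) + 1) atTop atTop :=
    tendsto_atTop_add_const_right _ _ tendsto_natCast_atTop_atTop
  have hgeom : Tendsto (fun k : ℕ => ((k : ℝ) + 2) * ρ ^ k * K) atTop (𝓝 0) := by
    have h1 := tendsto_self_mul_const_pow_of_lt_one hρ0 hρ1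
    have h2 := (tendsto_pow_atTop_nhds_zero_of_lt_one hρ0 hρ1).const_mul 2
    have h3 := (h1.add h2).mul_const K
    simp only [mul_zero, add_zero, zero_mul] at h3
    exact h3.congr fun k => by ring
  obtain ⟨k, hkε, hkμ, hkm, hkp, hkρ, hkK⟩ : ∃ k : ℕ, ((k : ℝ) + 2) * ρ ^ k * K < ε ∧
      ((k : ℝ) + 2) * ρ ^ k * K < μ ∧ 4 * K ^ 2 / m < (k : ℝ) + 1 ∧
      8 * K ^ 2 / (δ ^ 2 * p) < (k : ℝ) + 1 ∧ 1 / (1 - ρ) < (k : ℝ) + 1 ∧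
      16 * K / δ < (k : ℝ) + 1 :=
    ((hgeom.eventually_lt_const hε).and <| (hgeom.eventually_lt_const hμ).and <|
      (hlin.eventually_gt_atTop _).and <| (hlin.eventually_gt_atTop _).and <|
      (hlin.eventually_gt_atTop _).and (hlin.eventually_gt_atTop _)).exists
  rw [div_lt_iff₀ (by positivity)] at hkm hkp hkK
  rw [div_lt_iff₀ (sub_pos.2 hρ1)] at hkρ
  have hw : 1 / (4 * ((k : ℝ) + 1)) < 1 / (2 * ((k : ℝ) + 1)) := by
    apply one_div_lt_one_div_of_lt <;> linarith [(Nat.cast_nonneg k : (0 : ℝ) ≤ k)]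
  have hr : 0 < 1 / (4 * ((k : ℝ) + 1)) := by positivity
  have hs : ρ ≤ 1 - 1 / (2 * ((k : ℝ) + 1)) := by
    have : 1 / (2 * ((k : ℝ) + 1)) ≤ 1 - ρ := by
      rw [div_le_iff₀ (by positivity)]
      linarith
    linarith
  have hsmall : ∀ z : ℂ, ‖z‖ ≤ ρ → _ := fun z hz =>
    have hz1 := hKb z (hz.trans hρ1.le)
    h.norm_stepLeft_sub_le (k := k) hδ.le hδ1 hρ1.le hz hz1.2.1 hz1.2.2.2
  refine ⟨1 - 1 / (4 * ((k : ℝ) + 1)), 1 - 1 / (2 * ((k : ℝ) + 1)), δ * ((k : ℝ) + 1) / 8,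
    stepLeft δ k F G, stepRight δ k F G, h.isBalancedPair_step δ k (fun z hz => ?_)
    (fun z hz => ?_), hρ₀ρ.trans hs, by linarith, by linarith, by positivity, fun z hz => ?_,
    le_of_eq ?_, fun z hsz hzr => ?_⟩
  · obtain ⟨hFK, hGK, hF'K, hG'K⟩ := hKb z hz.le
    refine h.wedge_deriv_step_ne_zero hδ hδ1 hz hFK hGK hF'K hG'K (hkp.trans_le ?_)
    rw [mul_left_comm, ← mul_assoc]
    gcongr
    exact hpb z (by simpa using hz)
  · rcases le_total ‖z‖ ρ with hzρ | hzρ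
    · intro h0
      have h1 := (hsmall z hzρ).2
      rw [h0, zero_sub, norm_neg] at h1
      exact absurd (hμb z (by simpa using hz)) (by linarith)
    · obtain ⟨-, -, hF'K, hG'K⟩ := hKb z hz
      refine h.deriv_stepLeft_ne_zero hz hF'K hG'K ?_
      nlinarith [hρm z hzρ hz]
  · obtain ⟨h1, h2⟩ := hsmall z (hz.trans hρ₀ρ)
    exact ⟨h1.trans hkε.le, h2.trans hkε.le⟩
  · field_simp
    ring
  · have hz1 : ‖z‖ ≤ 1 := hzr.trans (by linarith)
    obtain ⟨-, -, hF'K, hG'K⟩ := hKb z hz1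
    exact h.le_norm_deriv_stepLeft hδ hδ1 hsz hz1 hF'K hG'K (hρG z (hs.trans hsz) hz1).le hkK.le

end IsBalancedPair

theorem deriv_smul_single (z : ℂ) :
    deriv (fun z : ℂ => z • EuclideanSpace.single (0 : Fin 2) (1 : ℂ)) z =
      EuclideanSpace.single 0 1 := by
  simpa using ((hasDerivAt_id z).smul_const (EuclideanSpace.single (0 : Fin 2) (1 : ℂ))).deriv

theorem isBalancedPair_initial :
    IsBalancedPair 1 (fun z => z • EuclideanSpace.single 0 1)
      (fun _ => EuclideanSpace.single 1 1) := by
  refine ⟨by fun_prop, by fun_prop, fun z hz => ?_, fun z hz => ?_, fun z hz => ?_, fun z hz => ?_,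
    fun z hz => ?_, fun z hz => ?_⟩
  · simp [norm_smul, hz]
  · simp
  · simp [EuclideanSpace.inner_single_left]
  · rintro h0
    simp [wedge] at h0
    simp [h0] at hz
  · simp [deriv_smul_single, wedge]
  · simp [deriv_smul_single]

/-- One stage of the inductive construction: a balanced pair, the size of the later
modifications, and the radius up to which they are controlled. -/
structure Stage where
  F : ℂ → EuclideanSpace ℂ (Fin 2)
  G : ℂ → EuclideanSpace ℂ (Fin 2)
  R : ℝ
  ε : ℝ
  r : ℝ

/-- The invariant of the inductive construction. -/
structure Stage.IsValid (n : ℕ) (S : Stage) : Prop where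
  isBalancedPair : IsBalancedPair S.R S.F S.G
  one_le_R : 1 ≤ S.R
  R_le : S.R ≤ 2 - 1 / ((n : ℝ) + 1)
  ε_pos : 0 < S.ε
  ε_le : ∀ z : ℂ, ‖z‖ ≤ 1 → 4 * S.ε ≤ ‖deriv S.F z‖
  r_lt : S.r < 1
  le_r : 1 - 1 / ((n : ℝ) + 1) ≤ S.r

/-- The relation between consecutive stages of the inductive construction. -/
structure Stage.IsNext (n : ℕ) (S T : Stage) : Prop where
  ε_le : T.ε ≤ S.ε / 2
  norm_sub_le : ∀ z : ℂ, ‖z‖ ≤ S.r → ‖T.F z - S.F z‖ ≤ S.ε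
  norm_deriv_sub_le : ∀ z : ℂ, ‖z‖ ≤ S.r → ‖deriv T.F z - deriv S.F z‖ ≤ S.ε
  exists_annulus : ∃ s L : ℝ, S.r ≤ s ∧ s ≤ T.r ∧ 0 < L ∧
    1 / (64 * ((n : ℝ) + 2)) ≤ L * (T.r - s) ∧
    ∀ z : ℂ, s ≤ ‖z‖ → ‖z‖ ≤ T.r → L ≤ ‖deriv T.F z‖

theorem Stage.IsValid.exists_next {n : ℕ} {S : Stage} (h : S.IsValid n) :
    ∃ T : Stage, T.IsValid (n + 1) ∧ S.IsNext n T := by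
  have hn : (0 : ℝ) ≤ n := Nat.cast_nonneg n
  set δ : ℝ := 1 / (2 * ((n : ℝ) + 2)) with hδ
  have hδ0 : 0 < δ := by positivity
  have hδ1 : δ ≤ 1 := by
    rw [hδ, div_le_one (by positivity)]
    linarith
  have hρ : max S.r (1 - 1 / ((n : ℝ) + 2)) < 1 := by
    refine max_lt h.r_lt ?_
    have : 0 < 1 / ((n : ℝ) + 2) := by positivity
    linarith
  obtain ⟨r, s, L, F, G, hb, hs, hsr, hr, hL, hsub, hδL, hder⟩ :=
    h.isBalancedPair.exists_step hδ0 hδ1 h.one_le_R h.ε_pos hρ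
  obtain ⟨μ, hμ, hμb⟩ := exists_pos_forall_le_of_isCompact (isCompact_closedBall (0 : ℂ) 1)
    hb.continuous_deriv_left.norm
    (fun z hz => norm_pos_iff.2 (hb.deriv_ne_zero z (by simpa using hz)))
  refine ⟨⟨F, G, (1 + δ ^ 2) * S.R, min (μ / 4) (S.ε / 2), r⟩, ⟨hb, ?_, ?_, ?_, ?_, hr, ?_⟩,
    ⟨min_le_right _ _, fun z hz => (hsub z (hz.trans (le_max_left _ _))).1,
      fun z hz => (hsub z (hz.trans (le_max_left _ _))).2,
      s, L, (le_max_left _ _).trans hs, hsr.le, hL, le_trans (le_of_eq ?_) hδL, hder⟩⟩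
  · nlinarith [h.one_le_R, sq_nonneg δ]
  · have h1 : (1 + δ ^ 2) * S.R ≤ (1 + δ ^ 2) * (2 - 1 / ((n : ℝ) + 1)) := by
      gcongr
      exact h.R_le
    refine h1.trans ?_
    have h2 : 2 - 1 / (((n + 1 : ℕ) : ℝ) + 1) - (1 + δ ^ 2) * (2 - 1 / ((n : ℝ) + 1)) =
        (2 * n + 7) / (4 * ((n : ℝ) + 1) * ((n : ℝ) + 2) ^ 2) := by
      rw [hδ]
      push_cast
      field_simp
      ring
    have h3 : 0 ≤ (2 * n + 7) / (4 * ((n : ℝ) + 1) * ((n : ℝ) + 2) ^ 2) := by positivity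
    linarith
  · exact lt_min (by positivity) (half_pos h.ε_pos)
  · intro z hz
    have h1 : min (μ / 4) (S.ε / 2) ≤ μ / 4 := min_le_left _ _
    have h2 := hμb z (by simpa using hz)
    linarith
  · have : 1 - 1 / ((n : ℝ) + 2) ≤ s := (le_max_right _ _).trans hs
    push_cast
    rw [show (n : ℝ) + 1 + 1 = n + 2 by ring]
    linarith
  · rw [hδ]
    field_simp
    norm_num

theorem exists_stage_seq :
    ∃ S : ℕ → Stage, ∀ n, (S n).IsValid n ∧ (S n).IsNext n (S (n + 1)) := by
  refine exists_seq_of_step (a := ⟨_, _, 1, 1 / 4, 0⟩)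
    ⟨isBalancedPair_initial, le_rfl, by norm_num, by norm_num, fun z _ => ?_, one_pos,
      by norm_num⟩ fun n S hS => hS.exists_next
  simp [deriv_smul_single]

/-- A sequence whose increments eventually halve converges, with error twice the increment. -/
theorem exists_tendsto_of_halving {E : Type*} [NormedAddCommGroup E] [CompleteSpace E]
    {u : ℕ → E} {ε : ℕ → ℝ} {n : ℕ} (hε : ∀ m, ε (m + 1) ≤ ε m / 2)
    (hu : ∀ m ≥ n, ‖u (m + 1) - u m‖ ≤ ε m) :
    ∃ l, Tendsto u atTop (𝓝 l) ∧ ∀ m ≥ n, ‖l - u m‖ ≤ 2 * ε m := by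
  have hgeom : ∀ m k, ε (m + k) ≤ ε m / 2 ^ k := fun m k => by
    induction k with
    | zero => simp
    | succ k ih =>
      calc ε (m + (k + 1)) ≤ ε (m + k) / 2 := hε (m + k)
        _ ≤ ε m / 2 ^ k / 2 := by gcongr
        _ = _ := by rw [div_div, pow_succ]
  have hdist : ∀ m ≥ n, ∀ k, dist (u (k + m)) (u (k + 1 + m)) ≤ 2 * ε m / 2 / 2 ^ k :=
    fun m hm k => by
      rw [dist_comm, dist_eq_norm, mul_div_cancel_left₀ _ two_ne_zero, add_right_comm]
      refine (hu (k + m) (by lia)).trans ?_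
      rw [add_comm k m]
      exact hgeom m k
  obtain ⟨l, hl⟩ := cauchySeq_tendsto_of_complete (cauchySeq_of_le_geometric_two (hdist n le_rfl))
  have hl' := (tendsto_add_atTop_iff_nat n).1 hl
  refine ⟨l, hl', fun m hm => ?_⟩
  have := dist_le_of_le_geometric_two_of_tendsto₀ (hdist m hm)
    ((tendsto_add_atTop_iff_nat (f := u) m).2 hl')
  rwa [zero_add, dist_comm, dist_eq_norm] at this

/-- Jones: a complete bounded immersed complex disc in ℂ². -/
theorem jones_complete_bounded_immersed_disc_C2 :
    ∃ φ : ℂ → EuclideanSpace ℂ (Fin 2),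
      DifferentiableOn ℂ φ (Metric.ball (0 : ℂ) 1) ∧
      (∃ M : ℝ, ∀ ζ ∈ Metric.ball (0 : ℂ) 1, ‖φ ζ‖ ≤ M) ∧
      (∀ ζ ∈ Metric.ball (0 : ℂ) 1, deriv φ ζ ≠ 0) ∧
      (∀ γ : ℝ → ℂ, DivergentPathIn (Metric.ball (0 : ℂ) 1) γ →
        eVariationOn (fun t => φ (γ t)) (Set.Ico 0 1) = ⊤) := by
  obtain ⟨S, hS⟩ := exists_stage_seq
  have hε : ∀ n, (S (n + 1)).ε ≤ (S n).ε / 2 := fun n => (hS n).2.ε_le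
  choose s L hrs hsr hL hLd hLder using fun n => (hS n).2.exists_annulus
  have hmono : Monotone fun n => (S n).r :=
    monotone_nat_of_le_succ fun n => (hrs n).trans (hsr n)
  have hr1 : Tendsto (fun n => (S n).r) atTop (𝓝 1) := by
    refine tendsto_of_tendsto_of_tendsto_of_le_of_le ?_ tendsto_const_nhds
      (fun n => (hS n).1.le_r) (fun n => (hS n).1.r_lt.le)
    simpa using tendsto_one_div_add_atTop_nhds_zero_nat (𝕜 := ℝ) |>.const_sub 1
  have hε0 : Tendsto (fun n => (S n).ε) atTop (𝓝 0) := by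
    have hgeom : ∀ n, (S n).ε ≤ (S 0).ε * (1 / 2) ^ n := fun n => by
      induction n with
      | zero => simp
      | succ n ih => rw [pow_succ]; linarith [hε n]
    refine squeeze_zero (fun n => (hS n).1.ε_pos.le) hgeom ?_
    simpa using (tendsto_pow_atTop_nhds_zero_of_lt_one (r := (1 / 2 : ℝ)) (by norm_num)
      (by norm_num)).const_mul (S 0).ε
  let φ : ℂ → EuclideanSpace ℂ (Fin 2) := fun z => limUnder atTop fun n => (S n).F z
  have hlim : ∀ n, ∀ z : ℂ, ‖z‖ ≤ (S n).r → Tendsto (fun n => (S n).F z) atTop (𝓝 (φ z)) ∧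
      ∀ m ≥ n, ‖φ z - (S m).F z‖ ≤ 2 * (S m).ε := fun n z hz => by
    obtain ⟨l, hl, hlm⟩ := exists_tendsto_of_halving (u := fun m => (S m).F z) hε
      fun m (hm : m ≥ n) => (hS m).2.norm_sub_le z (hz.trans (hmono hm))
    have : φ z = l := hl.limUnder_eq
    rw [this]
    exact ⟨hl, hlm⟩
  have hex : ∀ z ∈ ball (0 : ℂ) 1, ∃ n, ‖z‖ < (S n).r := fun z hz =>
    (hr1.eventually (lt_mem_nhds (by simpa using hz))).exists
  have hunif : TendstoLocallyUniformlyOn (fun n => (S n).F) φ atTop (ball 0 1) := by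
    rw [Metric.tendstoLocallyUniformlyOn_iff]
    intro e he z hz
    obtain ⟨n, hn⟩ := hex z hz
    refine ⟨{w | ‖w‖ < (S n).r}, mem_nhdsWithin_of_mem_nhds
      ((isOpen_lt continuous_norm continuous_const).mem_nhds hn), ?_⟩
    filter_upwards [hε0.eventually_lt_const (half_pos he), eventually_ge_atTop n] with m hm hmn w hw
    rw [dist_eq_norm]
    linarith [(hlim n w (le_of_lt hw)).2 m hmn]
  have hFd : ∀ᶠ n in atTop, DifferentiableOn ℂ (S n).F (ball 0 1) :=
    Eventually.of_forall fun n => (hS n).1.isBalancedPair.differentiable_left.differentiableOn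
  have hφ : DifferentiableOn ℂ φ (ball 0 1) := hunif.differentiableOn hFd isOpen_ball
  have hderiv : ∀ n, ∀ z : ℂ, ‖z‖ ≤ (S n).r → ‖deriv (S n).F z‖ / 2 ≤ ‖deriv φ z‖ := by
    intro n z hz
    have hz1 : ‖z‖ < 1 := hz.trans_lt (hS n).1.r_lt
    obtain ⟨l, hl, hlm⟩ := exists_tendsto_of_halving (u := fun m => deriv (S m).F z) hε
      fun m (hm : m ≥ n) => (hS m).2.norm_deriv_sub_le z (hz.trans (hmono hm))
    have h1 := (hunif.deriv hFd isOpen_ball).tendsto_at (by simpa using hz1)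
    rw [tendsto_nhds_unique h1 hl]
    have h2 := hlm n le_rfl
    rw [norm_sub_rev] at h2
    linarith [norm_sub_norm_le (deriv (S n).F z) l, (hS n).1.ε_le z hz1.le]
  refine ⟨φ, hφ, ⟨2, fun z hz => ?_⟩, fun z hz => ?_, fun γ hγ => ?_⟩
  · obtain ⟨n, hn⟩ := hex z hz
    refine le_of_tendsto (hlim n z hn.le).1.norm (Eventually.of_forall fun m => ?_)
    refine Complex.norm_le_of_forall_mem_frontier_norm_le isBounded_ball
      (hS m).1.isBalancedPair.differentiable_left.diffContOnCl (fun w hw => ?_) (subset_closure hz)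
    rw [frontier_ball _ one_ne_zero, mem_sphere_zero_iff_norm] at hw
    have h1 := (hS m).1.isBalancedPair.norm_left w hw
    have h2 := (hS m).1.R_le
    have h3 : 0 < 1 / ((m : ℝ) + 1) := by positivity
    nlinarith [norm_nonneg ((S m).F w)]
  · obtain ⟨n, hn⟩ := hex z hz
    have h1 := hderiv n z hn.le
    have h2 := (hS n).1.ε_le z (mem_ball_zero_iff.1 hz).le
    exact norm_pos_iff.1 (by linarith [(hS n).1.ε_pos])
  · obtain ⟨hγc, hγb, hγd⟩ := hγ
    refine eVariationOn_comp_eq_top (c := fun n => L n / 4)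
      (d := fun n => 1 / 256 * (1 / ((n + 2 : ℕ) : ℝ))) hφ
      (fun n => (hS n).1.r_lt) hr1 hrs hsr (fun n => by linarith [hL n])
      (fun n z _ h1 h2 => ?_) (fun n => by positivity) (fun n => ?_) ?_ hγc hγb fun ρ hρ => ?_
    · linarith [hderiv (n + 1) z h2, hLder n z h1 h2, hL n]
    · have h1 : 1 / 256 * (1 / ((n + 2 : ℕ) : ℝ)) = 1 / (64 * ((n : ℝ) + 2)) / 4 := by
        push_cast
        field_simp
        norm_num
      rw [h1]
      linarith [hLd n]
    · rw [summable_mul_left_iff (by norm_num), summable_nat_add_iff (f := fun n : ℕ => 1 / (n : ℝ)) 2]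
      exact Real.not_summable_one_div_natCast
    · obtain ⟨t, ht, htK⟩ := hγd (closedBall 0 ρ) (closedBall_subset_ball hρ)
        (isCompact_closedBall 0 ρ)
      refine ⟨t, ht, ?_⟩
      have := htK t ⟨le_rfl, ht.2⟩
      rw [mem_closedBall_zero_iff, not_le] at this
      exact this.le
end
end

section
/- There exists a holomorphic map φ : 𝔻 → ℂ⁴ which is injective, is an immersion (φ'(ζ) ≠ 0 for every ζ ∈ 𝔻), has image contained in the open unit ball 𝔹₄ ⊆ ℂ⁴, is proper as a map from 𝔻 into 𝔹₄ (preimages of compact subsets of 𝔹₄ are compact), and is complete: for every divergent path γ : [0,1) → 𝔻 the path φ ∘ γ has infinite length. (Jones: existence of a complete properly embedded complex disc in 𝔹₄.) -/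
open Set Metric
open scoped ENNReal

noncomputable section

open Filter Topology

/-- If locally `h` varies no more than `f`, then the length of `f ∘ γ` controls the change of `h`
along `γ`. -/
theorem edist_le_eVariationOn_comp_of_eventually {X E : Type*} [TopologicalSpace X]
    [PseudoEMetricSpace E] {f : X → E} {h : X → ℝ} {γ : ℝ → X} {s t : ℝ} (hst : s ≤ t)
    (hγ : ContinuousOn γ (Icc s t))
    (H : ∀ τ ∈ Icc s t, ∀ᶠ p in 𝓝 (γ τ) ×ˢ 𝓝 (γ τ), edist (h p.1) (h p.2) ≤ edist (f p.1) (f p.2)) :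
    edist (h (γ s)) (h (γ t)) ≤ eVariationOn (f ∘ γ) (Icc s t) := by
  have hW : ∀ τ : Icc s t, ∃ W : Set X, IsOpen W ∧ γ τ ∈ W ∧
      ∀ x ∈ W, ∀ y ∈ W, edist (h x) (h y) ≤ edist (f x) (f y) := by
    intro τ
    obtain ⟨V, hV, hVW⟩ := eventually_prod_self_iff'.1 (H τ τ.2)
    obtain ⟨W, hWV, hWo, hτ⟩ := mem_nhds_iff.1 hV
    exact ⟨W, hWo, hτ, fun x hx y hy => hVW x (hWV hx) y (hWV hy)⟩
  choose W hWo hτW hW using hW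
  obtain ⟨u, hu0, hu, ⟨m, hm⟩, huW⟩ := exists_monotone_Icc_subset_open_cover_Icc hst
    (c := fun τ => (Icc s t).domRestrict γ ⁻¹' W τ)
    (fun τ => (hWo τ).preimage hγ.domRestrict) (fun τ _ => mem_iUnion.2 ⟨τ, hτW τ⟩)
  have hsum := edist_le_range_sum_edist (fun i => h (γ (u i))) m
  rw [hm m le_rfl, hu0] at hsum
  refine hsum.trans (le_trans (Finset.sum_le_sum fun i _ => ?_)
    (eVariationOn.sum_le (n := m) (u := fun i => (u i : ℝ)) (fun i j hij => hu hij)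
      fun i => (u i).2))
  obtain ⟨τ, hτ⟩ := huW i
  have h1 : γ (u i) ∈ W τ := hτ (left_mem_Icc.2 (hu i.le_succ))
  have h2 : γ (u (i + 1)) ∈ W τ := hτ (right_mem_Icc.2 (hu i.le_succ))
  rw [edist_comm ((f ∘ γ) _)]
  exact hW τ _ h1 _ h2

theorem HasStrictDerivAt.eventually_norm_sub_le_norm_sub {E : Type*} [NormedAddCommGroup E]
    [NormedSpace ℂ E] {f : ℂ → E} {g : ℂ → ℂ} {f' : E} {g' z : ℂ}
    (hf : HasStrictDerivAt f f' z) (hg : HasStrictDerivAt g g' z) (hlt : ‖g'‖ < ‖f'‖) :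
    ∀ᶠ p in 𝓝 z ×ˢ 𝓝 z, ‖g p.1 - g p.2‖ ≤ ‖f p.1 - f p.2‖ := by
  have hε : 0 < (‖f'‖ - ‖g'‖) / 2 := by linarith
  have h1 := (hasStrictDerivAt_iff_hasStrictFDerivAt.1 hf).isLittleO.def hε
  have h2 := (hasStrictDerivAt_iff_hasStrictFDerivAt.1 hg).isLittleO.def hε
  rw [nhds_prod_eq] at h1 h2
  filter_upwards [h1, h2] with p h1 h2
  have e1 := norm_sub_norm_le ((p.1 - p.2) • f') (f p.1 - f p.2)
  have e2 := norm_sub_norm_le (g p.1 - g p.2) ((p.1 - p.2) • g')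
  rw [norm_smul] at e1 e2
  simp only [ContinuousLinearMap.toSpanSingleton_apply] at h1 h2
  rw [norm_sub_rev] at h1
  nlinarith [norm_nonneg (p.1 - p.2)]

/-- Along a path on which `‖g‖` climbs from `a` to `b`, the image under `f` has length at least
`b - a`, provided `f` expands more than `g` where `a ≤ ‖g‖ ≤ b`. -/
theorem ofReal_sub_le_eVariationOn_comp {E : Type*} [NormedAddCommGroup E] [NormedSpace ℂ E]
    [CompleteSpace E] {f : ℂ → E} {g : ℂ → ℂ} {Ω : Set ℂ} {a b : ℝ} (hab : a ≤ b) (hΩ : IsOpen Ω)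
    (hf : DifferentiableOn ℂ f Ω) (hg : DifferentiableOn ℂ g Ω)
    (hlt : ∀ z ∈ Ω, a ≤ ‖g z‖ → ‖g z‖ ≤ b → ‖deriv g z‖ < ‖deriv f z‖)
    {γ : ℝ → ℂ} {s t : ℝ} (hst : s ≤ t) (hγ : ContinuousOn γ (Icc s t)) (hγΩ : MapsTo γ (Icc s t) Ω)
    (hs : ‖g (γ s)‖ ≤ a) (ht : b ≤ ‖g (γ t)‖) :
    ENNReal.ofReal (b - a) ≤ eVariationOn (f ∘ γ) (Icc s t) := by
  have key := edist_le_eVariationOn_comp_of_eventually (f := f)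
    (h := fun z => max a (min b ‖g z‖)) hst hγ ?_
  · refine le_trans (le_of_eq ?_) key
    simp only [min_eq_left ht, max_eq_right hab, min_eq_right (hs.trans hab), max_eq_left hs]
    rw [edist_comm, edist_dist, Real.dist_eq, abs_of_nonneg (sub_nonneg.2 hab)]
  intro τ hτ
  have hΩτ := hΩ.mem_nhds (hγΩ hτ)
  have hcont : Tendsto (fun z => ‖g z‖) (𝓝 (γ τ)) (𝓝 ‖g (γ τ)‖) :=
    (hg.differentiableAt hΩτ).continuousAt.norm
  rcases lt_or_ge ‖g (γ τ)‖ a with h1 | h1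
  · have h2 := hcont.eventually_lt_const h1
    filter_upwards [h2.prod_inl (𝓝 (γ τ)), h2.prod_inr (𝓝 (γ τ))] with p hp hq
    simp [max_eq_left ((min_le_right b _).trans hp.le), max_eq_left ((min_le_right b _).trans hq.le)]
  rcases lt_or_ge b ‖g (γ τ)‖ with h3 | h3
  · have h2 := hcont.eventually_const_lt h3
    filter_upwards [h2.prod_inl (𝓝 (γ τ)), h2.prod_inr (𝓝 (γ τ))] with p hp hq
    simp [min_eq_left hp.le, min_eq_left hq.le]
  have hloc := (hf.analyticAt hΩτ).hasStrictDerivAt.eventually_norm_sub_le_norm_sub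
    (hg.analyticAt hΩτ).hasStrictDerivAt (hlt _ (hγΩ hτ) h1 h3)
  filter_upwards [hloc] with p hp
  rw [edist_dist, edist_dist]
  refine ENNReal.ofReal_le_ofReal ?_
  rw [dist_eq_norm (f _), Real.dist_eq]
  refine le_trans ?_ hp
  refine le_trans ?_ (abs_norm_sub_norm_le (g p.1) (g p.2))
  refine (abs_max_sub_max_le_max _ _ _ _).trans (max_le (by simp) ?_)
  exact (abs_min_sub_min_le_max _ _ _ _).trans (max_le (by simp) le_rfl)

/-- On the unit circle, `F` and `U` are orthogonal and both have norm `√c`. -/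
structure OrthogonalOnCircle {E : Type*} [NormedAddCommGroup E] [InnerProductSpace ℂ E]
    (c : ℝ) (F U : ℂ → E) : Prop where
  diff_left : Differentiable ℂ F
  diff_right : Differentiable ℂ U
  norm_left : ∀ z, ‖z‖ = 1 → ‖F z‖ ^ 2 = c
  norm_right : ∀ z, ‖z‖ = 1 → ‖U z‖ ^ 2 = c
  inner_eq : ∀ z, ‖z‖ = 1 → inner ℂ (F z) (U z) = 0

/-- The relations on the unit circle hold approximately on the annulus `ρ ≤ ‖z‖ ≤ 1`. -/
def NearlyOrthogonalOn {E : Type*} [NormedAddCommGroup E] [InnerProductSpace ℂ E]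
    (c ε ρ : ℝ) (F U : ℂ → E) : Prop :=
  ∀ z, ρ ≤ ‖z‖ → ‖z‖ ≤ 1 →
    c - ε < ‖F z‖ ^ 2 ∧ ‖inner ℂ (F z) (U z)‖ < ε ∧ c / 4 < ‖U z‖ ^ 2

theorem exists_radius_forall_pos {u : ℂ → ℝ} (hu : Continuous u) (hpos : ∀ z, ‖z‖ = 1 → 0 < u z)
    {r : ℝ} (hr : r < 1) : ∃ ρ, r < ρ ∧ ρ < 1 ∧ ∀ z, ρ ≤ ‖z‖ → ‖z‖ ≤ 1 → 0 < u z := by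
  have hK : IsCompact (closedBall (0 : ℂ) 1 ∩ {z | u z ≤ 0}) :=
    (isCompact_closedBall 0 1).inter_right (isClosed_le hu continuous_const)
  obtain ⟨a, ha, hKa⟩ : ∃ a < 1, ∀ z, ‖z‖ ≤ 1 → u z ≤ 0 → ‖z‖ ≤ a := by
    rcases (closedBall (0 : ℂ) 1 ∩ {z | u z ≤ 0}).eq_empty_or_nonempty with h | h
    · refine ⟨0, one_pos, fun z h1 h2 => ?_⟩
      have : z ∈ closedBall (0 : ℂ) 1 ∩ {z | u z ≤ 0} := ⟨by simpa using h1, h2⟩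
      simp [h] at this
    · obtain ⟨w, hw, hmax⟩ := hK.exists_isMaxOn h continuous_norm.continuousOn
      refine ⟨‖w‖, lt_of_le_of_ne (by simpa using hw.1) fun h1 => (hpos w h1).not_ge hw.2, ?_⟩
      exact fun z h1 h2 => hmax ⟨by simpa using h1, h2⟩
  refine ⟨(max r a + 1) / 2, ?_, ?_, fun z h1 h2 => ?_⟩
  · linarith [le_max_left r a]
  · linarith [max_lt hr ha]
  · by_contra! h3
    linarith [hKa z h2 h3, le_max_right r a, max_lt hr ha]

namespace OrthogonalOnCircle

variable {E : Type*} [NormedAddCommGroup E] [InnerProductSpace ℂ E] {c : ℝ} {F U : ℂ → E}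

theorem exists_nearlyOrthogonalOn (h : OrthogonalOnCircle c F U) (hc : 0 < c) {ε r : ℝ}
    (hε : 0 < ε) (hr : r < 1) : ∃ ρ, r < ρ ∧ ρ < 1 ∧ NearlyOrthogonalOn c ε ρ F U := by
  have hF := h.diff_left.continuous
  have hU := h.diff_right.continuous
  obtain ⟨ρ, hrρ, hρ, hpos⟩ := exists_radius_forall_pos
    (u := fun z => min (‖F z‖ ^ 2 - (c - ε)) (min (ε - ‖inner ℂ (F z) (U z)‖) (‖U z‖ ^ 2 - c / 4)))
    (by fun_prop)
    (fun z hz => by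
      simp only [h.norm_left z hz, h.norm_right z hz, h.inner_eq z hz, lt_min_iff, norm_zero]
      exact ⟨by linarith, by linarith, by linarith⟩) hr
  refine ⟨ρ, hrρ, hρ, fun z h1 h2 => ?_⟩
  have := hpos z h1 h2
  simp only [lt_min_iff, sub_pos] at this
  exact this

theorem norm_sq_le (h : OrthogonalOnCircle c F U) {z : ℂ} (hz : ‖z‖ ≤ 1) : ‖F z‖ ^ 2 ≤ c := by
  have hc : 0 ≤ c := h.norm_left 1 (by simp) ▸ sq_nonneg _
  have : ‖F z‖ ≤ √c := by
    refine Complex.norm_le_of_forall_mem_frontier_norm_le (isBounded_ball (x := (0 : ℂ)) (r := 1))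
      h.diff_left.diffContOnCl (fun w hw => ?_) ?_
    · rw [frontier_ball _ one_ne_zero, mem_sphere_zero_iff_norm] at hw
      rw [← h.norm_left w hw, Real.sqrt_sq (norm_nonneg _)]
    · rw [closure_ball _ one_ne_zero]
      simpa using hz
  calc ‖F z‖ ^ 2 ≤ √c ^ 2 := by gcongr
    _ = c := Real.sq_sqrt hc

/-- Adding to `F` a rapidly oscillating multiple of the orthogonal map `U` preserves the frame. -/
theorem twist (h : OrthogonalOnCircle c F U) (δ : ℝ) (N : ℕ) :
    OrthogonalOnCircle (c * (1 + δ ^ 2)) (fun z => F z + ((δ : ℂ) * z ^ N) • U z)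
      (fun z => z ^ N • U z - (δ : ℂ) • F z) := by
  have hF := h.diff_left
  have hU := h.diff_right
  have hUF : ∀ z, ‖z‖ = 1 → inner ℂ (U z) (F z) = 0 := fun z hz =>
    inner_eq_zero_symm.1 (h.inner_eq z hz)
  refine ⟨by fun_prop, by fun_prop, fun z hz => ?_, fun z hz => ?_, fun z hz => ?_⟩
  · rw [norm_add_sq (𝕜 := ℂ), inner_smul_right, h.inner_eq z hz, norm_smul, mul_pow,
      h.norm_left z hz, h.norm_right z hz]
    simp [hz]
    ring
  · rw [norm_sub_sq (𝕜 := ℂ), inner_smul_right, inner_smul_left, hUF z hz, norm_smul, norm_smul,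
      mul_pow, mul_pow, h.norm_left z hz, h.norm_right z hz]
    simp [hz]
    ring
  · have hzz : (starRingEnd ℂ) z ^ N * z ^ N = 1 := by
      rw [← mul_pow, mul_comm, Complex.mul_conj, Complex.normSq_eq_norm_sq, hz]
      simp
    simp only [inner_add_left, inner_sub_right, inner_smul_left, inner_smul_right, h.inner_eq z hz,
      hUF z hz, inner_self_eq_norm_sq_to_K, map_mul, map_pow, Complex.conj_ofReal]
    have h1 : ((‖F z‖ : ℝ) : ℂ) ^ 2 = c := by exact_mod_cast h.norm_left z hz
    have h2 : ((‖U z‖ : ℝ) : ℂ) ^ 2 = c := by exact_mod_cast h.norm_right z hz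
    simp only [Complex.coe_algebraMap, h1, h2]
    linear_combination (δ * c : ℂ) * hzz

theorem exists_twist [CompleteSpace E] (h : OrthogonalOnCircle c F U) (hc : 0 < c)
    {c' ε ρ η : ℝ} (hcc' : c < c') (hc' : c' ≤ 2 * c) (hρ0 : 0 ≤ ρ) (hρ : ρ < 1) (hnear : NearlyOrthogonalOn c ε ρ F U)
    (hη : 0 < η) :
    ∃ G V : ℂ → E, OrthogonalOnCircle c' G V ∧
      (∀ z, ‖z‖ ≤ ρ → ‖G z - F z‖ ≤ η ∧ ‖deriv G z - deriv F z‖ ≤ η) ∧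
      (∀ z, ρ ≤ ‖z‖ → ‖z‖ ≤ 1 → c - 3 * ε ≤ ‖G z‖ ^ 2) ∧
      ∃ n : ℕ, ρ ^ (n + 1) < 1 / 4 ∧ ∀ z, ‖z‖ ≤ 1 → 1 / 4 ≤ ‖z‖ ^ (n + 1) →
        √(c' - c) / 4 * ((n + 1) * ‖z‖ ^ n) + 2 ≤ ‖deriv G z‖ := by
  set δ : ℝ := √((c' - c) / c) with hδ
  have hδ0 : 0 < δ := Real.sqrt_pos.2 (div_pos (sub_pos.2 hcc') hc)
  have hδsq : δ ^ 2 = (c' - c) / c := Real.sq_sqrt (div_pos (sub_pos.2 hcc') hc).le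
  have hδ1 : δ ≤ 1 := Real.sqrt_le_one.2 ((div_le_one hc).2 (by linarith))
  have hκ : 0 < √(c' - c) := Real.sqrt_pos.2 (sub_pos.2 hcc')
  have hcδ : c * (1 + δ ^ 2) = c' := by rw [hδsq]; field_simp; ring
  obtain ⟨M, hM⟩ : ∃ M, ∀ z : ℂ, ‖z‖ ≤ 1 → ‖U z‖ ≤ M ∧ ‖deriv U z‖ ≤ M ∧ ‖deriv F z‖ ≤ M := by
    have hU' : Continuous (deriv U) := h.diff_right.contDiff.continuous_deriv_one
    have hF' : Continuous (deriv F) := h.diff_left.contDiff.continuous_deriv_one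
    have hU := h.diff_right.continuous
    obtain ⟨M, hM⟩ := (isCompact_closedBall (0 : ℂ) 1).exists_bound_of_continuousOn
      (f := fun z => ‖U z‖ + ‖deriv U z‖ + ‖deriv F z‖) (by fun_prop)
    refine ⟨M, fun z hz => ?_⟩
    have h1 := (le_abs_self _).trans (hM z (by simpa using hz))
    refine ⟨?_, ?_, ?_⟩ <;>
      linarith [norm_nonneg (U z), norm_nonneg (deriv U z), norm_nonneg (deriv F z)]
  have hM0 : 0 ≤ M := (norm_nonneg _).trans (hM 0 (by simp)).1
  obtain ⟨n, hn1, hn2, hn3⟩ : ∃ n : ℕ, ρ ^ (n + 1) < 1 / 4 ∧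
      M * ((n + 1) * ρ ^ n + ρ ^ (n + 1)) ≤ η ∧ 2 * M + 2 ≤ √(c' - c) / 16 * (n + 1) := by
    have t0 : Tendsto (fun n : ℕ => ρ ^ n) atTop (𝓝 0) := tendsto_pow_atTop_nhds_zero_of_lt_one hρ0 hρ
    have t1 := (tendsto_add_atTop_iff_nat 1).2 t0
    have t2 : Tendsto (fun n : ℕ => M * (((n : ℝ) + 1) * ρ ^ n + ρ ^ (n + 1))) atTop (𝓝 0) := by
      have := (((tendsto_self_mul_const_pow_of_lt_one hρ0 hρ).add t0).add t1).const_mul M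
      simp only [add_zero, mul_zero] at this
      refine this.congr fun n => by ring
    have t3 : Tendsto (fun n : ℕ => √(c' - c) / 16 * ((n : ℝ) + 1)) atTop atTop :=
      (tendsto_natCast_atTop_atTop.atTop_add tendsto_const_nhds).const_mul_atTop (by positivity)
    exact ((t1.eventually_lt_const (by norm_num)).and ((t2.eventually_le_const hη).and
      (t3.eventually_ge_atTop _))).exists
  have hG : ∀ z, HasDerivAt (fun z => F z + ((δ : ℂ) * z ^ (n + 1)) • U z)
      (deriv F z + (((δ : ℂ) * z ^ (n + 1)) • deriv U z
        + ((δ : ℂ) * ((n + 1 : ℝ) * z ^ n)) • U z)) z := by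
    intro z
    have h1 : HasDerivAt (fun z : ℂ => (δ : ℂ) * z ^ (n + 1)) ((δ : ℂ) * ((n + 1 : ℝ) * z ^ n)) z := by
      simpa using (hasDerivAt_pow (n + 1) z).const_mul (δ : ℂ)
    exact (h.diff_left z).hasDerivAt.add (h1.smul (h.diff_right z).hasDerivAt)
  have hn0 : (0 : ℝ) ≤ n + 1 := by positivity
  have hna : ‖((n + 1 : ℝ) : ℂ)‖ = n + 1 := by rw [Complex.norm_real, Real.norm_of_nonneg hn0]
  have hδa : ‖(δ : ℂ)‖ = δ := by rw [Complex.norm_real, Real.norm_of_nonneg hδ0.le]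
  refine ⟨_, _, hcδ ▸ h.twist δ (n + 1), fun z hz => ?_, fun z hz hz1 => ?_, n, hn1,
    fun z hz hzn => ?_⟩
  · obtain ⟨b1, b2, -⟩ := hM z (hz.trans hρ.le)
    have e1 : ‖z‖ ^ n ≤ ρ ^ n := by gcongr
    have e2 : ‖z‖ ^ (n + 1) ≤ ρ ^ (n + 1) := by gcongr
    have f1 : δ * ‖z‖ ^ (n + 1) * ‖U z‖ ≤ 1 * ρ ^ (n + 1) * M := by gcongr
    have f2 : δ * ‖z‖ ^ (n + 1) * ‖deriv U z‖ ≤ 1 * ρ ^ (n + 1) * M := by gcongr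
    have f3 : δ * ((n + 1) * ‖z‖ ^ n) * ‖U z‖ ≤ 1 * ((n + 1) * ρ ^ n) * M := by gcongr
    have f4 : 0 ≤ M * ((n + 1) * ρ ^ n) := by positivity
    rw [(hG z).deriv, add_sub_cancel_left, add_sub_cancel_left]
    refine ⟨?_, (norm_add_le _ _).trans ?_⟩
    · rw [norm_smul, norm_mul, norm_pow, hδa]
      linarith
    · rw [norm_smul, norm_smul, norm_mul, norm_mul, norm_mul, norm_pow, norm_pow, hδa, hna]
      linarith
  · obtain ⟨b1, b2, -⟩ := hnear z hz hz1
    rw [norm_add_sq (𝕜 := ℂ), inner_smul_right]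
    have e1 := (abs_le.1 (Complex.abs_re_le_norm
      ((δ : ℂ) * z ^ (n + 1) * inner ℂ (F z) (U z)))).1
    rw [norm_mul, norm_mul, norm_pow, hδa] at e1
    have e2 : δ * ‖z‖ ^ (n + 1) * ‖inner ℂ (F z) (U z)‖ ≤ 1 * 1 * ε := by
      gcongr
      exact pow_le_one₀ (norm_nonneg _) hz1
    rw [RCLike.re_eq_complex_re]
    nlinarith [sq_nonneg ‖((δ : ℂ) * z ^ (n + 1)) • U z‖]
  · have hρz : ρ ≤ ‖z‖ := by
      by_contra! h1
      have : ‖z‖ ^ (n + 1) ≤ ρ ^ (n + 1) := by gcongr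
      linarith
    obtain ⟨b1, b2, b3⟩ := hM z hz
    have hUz := (hnear z hρz hz).2.2
    have e1 : √(c' - c) / 2 ≤ δ * ‖U z‖ := by
      refine (sq_le_sq₀ (by positivity) (by positivity)).1 ?_
      rw [div_pow, mul_pow, hδsq, Real.sq_sqrt (sub_pos.2 hcc').le]
      calc (c' - c) / 2 ^ 2 = (c' - c) / c * (c / 4) := by field_simp; norm_num
        _ ≤ _ := mul_le_mul_of_nonneg_left hUz.le (div_pos (sub_pos.2 hcc') hc).le
    have e2 : 1 / 4 ≤ ‖z‖ ^ n := hzn.trans (pow_le_pow_of_le_one (norm_nonneg _) hz n.le_succ)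
    have e3 : ‖z‖ ^ (n + 1) ≤ 1 := pow_le_one₀ (norm_nonneg _) hz
    rw [(hG z).deriv]
    set x := ((δ : ℂ) * ((n + 1 : ℝ) * z ^ n)) • U z with hx
    set y := ((δ : ℂ) * z ^ (n + 1)) • deriv U z with hy
    have hxn : ‖x‖ = (n + 1) * ‖z‖ ^ n * (δ * ‖U z‖) := by
      rw [hx, norm_smul, norm_mul, norm_mul, norm_pow, hδa, hna]
      ring
    have hyn : ‖y‖ ≤ M := by
      rw [hy, norm_smul, norm_mul, norm_pow, hδa]
      calc δ * ‖z‖ ^ (n + 1) * ‖deriv U z‖ ≤ 1 * 1 * M := by gcongr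
        _ = M := by ring
    have t1 : ‖x‖ ≤ ‖deriv F z + (y + x)‖ + ‖deriv F z‖ + ‖y‖ := by
      calc ‖x‖ = ‖deriv F z + (y + x) - deriv F z - y‖ := by congr 1; abel
        _ ≤ _ := (norm_sub_le _ _).trans (by gcongr; exact norm_sub_le _ _)
    have t2 : (n + 1) * ‖z‖ ^ n * (√(c' - c) / 2) ≤ ‖x‖ := by
      rw [hxn]; gcongr
    have t3 : √(c' - c) / 4 * ((n + 1) * (1 / 4)) ≤ √(c' - c) / 4 * ((n + 1) * ‖z‖ ^ n) := by gcongr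
    linarith

end OrthogonalOnCircle

/-- The squared norms on the unit circle of the approximating maps. -/
def circleNormSq (n : ℕ) : ℝ := 3 / 4 - 1 / (n + 2)

theorem circleNormSq_succ_sub (n : ℕ) :
    circleNormSq (n + 1) - circleNormSq n = 1 / ((n + 2) * (n + 3)) := by
  unfold circleNormSq
  push_cast
  field_simp
  ring

theorem one_fourth_le_circleNormSq (n : ℕ) : 1 / 4 ≤ circleNormSq n := by
  have : (1 : ℝ) / (n + 2) ≤ 1 / 2 :=
    one_div_le_one_div_of_le two_pos (by linarith [n.cast_nonneg (α := ℝ)])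
  unfold circleNormSq
  linarith

theorem circleNormSq_lt (n : ℕ) : circleNormSq n < 3 / 4 := by
  have : (0 : ℝ) < 1 / (n + 2) := by positivity
  unfold circleNormSq
  linarith

theorem circleNormSq_lt_succ (n : ℕ) : circleNormSq n < circleNormSq (n + 1) := by
  rw [← sub_pos, circleNormSq_succ_sub]
  positivity

theorem circleNormSq_succ_le (n : ℕ) : circleNormSq (n + 1) ≤ 2 * circleNormSq n := by
  have h1 := circleNormSq_succ_sub n
  have h2 : (1 : ℝ) / ((n + 2) * (n + 3)) ≤ 1 / 6 :=
    one_div_le_one_div_of_le (by norm_num) (by nlinarith [n.cast_nonneg (α := ℝ)])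
  linarith [one_fourth_le_circleNormSq n]

theorem tendsto_circleNormSq : Tendsto circleNormSq atTop (𝓝 (3 / 4)) := by
  have h := tendsto_one_div_add_atTop_nhds_zero_nat (𝕜 := ℝ)
  have h2 := ((tendsto_add_atTop_iff_nat 1).2 h).const_sub (3 / 4)
  rw [sub_zero] at h2
  refine h2.congr fun n => ?_
  unfold circleNormSq
  push_cast
  ring_nf

theorem one_div_le_sqrt_circleNormSq_succ_sub (n : ℕ) :
    1 / (n + 3) ≤ √(circleNormSq (n + 1) - circleNormSq n) := by
  rw [circleNormSq_succ_sub]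
  refine Real.le_sqrt_of_sq_le ?_
  rw [div_pow, one_pow]
  exact one_div_le_one_div_of_le (by positivity) (by nlinarith [n.cast_nonneg (α := ℝ)])

section Approximation

variable {E : Type*} [NormedAddCommGroup E] [InnerProductSpace ℂ E]

/-- `G` and `σ` continue the approximation that has reached `F` and `ρ` after `n` steps. -/
structure IsRefinement (n : ℕ) (F G : ℂ → E) (ρ σ : ℝ) : Prop where
  radius_le : ρ ≤ σ
  dist_le : ∀ z, ‖z‖ ≤ ρ → dist (F z) (G z) ≤ (1 / 2) ^ n
  dist_deriv_le : ∀ z, ‖z‖ ≤ ρ → dist (deriv F z) (deriv G z) ≤ (1 / 2) ^ n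
  le_norm_sq : ∀ z, ρ ≤ ‖z‖ → ‖z‖ ≤ 1 → circleNormSq n - 3 * (1 / 2) ^ n ≤ ‖G z‖ ^ 2
  exists_le_norm_deriv : ∃ N : ℕ, ρ ^ (N + 1) < 1 / 4 ∧ 3 / 4 < σ ^ (N + 1) ∧
    ∀ z, ‖z‖ ≤ 1 → 1 / 4 ≤ ‖z‖ ^ (N + 1) →
      √(circleNormSq (n + 1) - circleNormSq n) / 4 * ((N + 1) * ‖z‖ ^ N) + 2 ≤ ‖deriv G z‖

variable (E) in
/-- A sequence of entire maps and radii in which each term refines the previous one. -/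
structure Approximation where
  map : ℕ → ℂ → E
  radius : ℕ → ℝ
  differentiable : ∀ n, Differentiable ℂ (map n)
  norm_sq_le : ∀ n z, ‖z‖ ≤ 1 → ‖map n z‖ ^ 2 ≤ circleNormSq n
  le_radius : ∀ n : ℕ, 1 - 1 / (n + 1 : ℝ) ≤ radius n
  radius_lt : ∀ n, radius n < 1
  isRefinement : ∀ n, IsRefinement n (map n) (map (n + 1)) (radius n) (radius (n + 1))

theorem nonempty_approximation [CompleteSpace E] {e₁ e₂ : E} (h₁ : ‖e₁‖ = 1) (h₂ : ‖e₂‖ = 1)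
    (h₁₂ : inner ℂ e₁ e₂ = 0) : Nonempty (Approximation E) := by
  let Good : ℕ → (ℂ → E) × (ℂ → E) × ℝ → Prop := fun n s =>
    OrthogonalOnCircle (circleNormSq n) s.1 s.2.1 ∧ 1 - 1 / (n + 1 : ℝ) ≤ s.2.2 ∧ s.2.2 < 1 ∧
      NearlyOrthogonalOn (circleNormSq n) ((1 / 2) ^ n) s.2.2 s.1 s.2.1
  have hpos : ∀ n, 0 < circleNormSq n := fun n =>
    lt_of_lt_of_le (by norm_num) (one_fourth_le_circleNormSq n)
  have hrad : ∀ n : ℕ, (1 - 1 / (n + 1 : ℝ)) < 1 := fun n => by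
    have : (0 : ℝ) < 1 / (n + 1) := by positivity
    linarith
  have hstart : ∃ s, Good 0 s := by
    have h0 : OrthogonalOnCircle (circleNormSq 0) (fun _ => (1 / 2 : ℂ) • e₁)
        (fun _ => (1 / 2 : ℂ) • e₂) := by
      refine ⟨by fun_prop, by fun_prop, fun z _ => ?_, fun z _ => ?_, fun z _ => ?_⟩
      · rw [norm_smul, h₁, circleNormSq]; norm_num
      · rw [norm_smul, h₂, circleNormSq]; norm_num
      · rw [inner_smul_left, inner_smul_right, h₁₂]; simp
    obtain ⟨ρ, hρ, hρ1, hnear⟩ := h0.exists_nearlyOrthogonalOn (hpos 0)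
      (ε := (1 / 2) ^ 0) (by norm_num) (hrad 0)
    exact ⟨(_, _, ρ), h0, hρ.le, hρ1, hnear⟩
  have hstep : ∀ n s, Good n s → ∃ s', Good (n + 1) s' ∧ IsRefinement n s.1 s'.1 s.2.2 s'.2.2 := by
    rintro n ⟨F, U, ρ⟩ ⟨hFU, hρn, hρ1, hnear⟩
    dsimp only at hFU hρn hρ1 hnear
    have hρ0 : 0 ≤ ρ := by
      refine le_trans ?_ hρn
      rw [sub_nonneg]
      exact (div_le_one (by positivity)).2 (by linarith [n.cast_nonneg (α := ℝ)])
    obtain ⟨G, V, hGV, hclose, hlow, N, hN, hderiv⟩ := hFU.exists_twist (hpos n)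
      (circleNormSq_lt_succ n) (circleNormSq_succ_le n) hρ0 hρ1 hnear (η := (1 / 2) ^ n)
      (by positivity)
    obtain ⟨r, hr, hr0, hr1⟩ : ∃ r : ℝ, 3 / 4 < r ^ (N + 1) ∧ 0 < r ∧ r < 1 := by
      have : Tendsto (fun r : ℝ => r ^ (N + 1)) (𝓝[<] 1) (𝓝 (1 ^ (N + 1))) :=
        ((continuous_pow (N + 1)).tendsto 1).mono_left nhdsWithin_le_nhds
      exact ((this.eventually_const_lt (by norm_num)).and (Ioo_mem_nhdsLT one_pos)).exists
    obtain ⟨σ, hσ, hσ1, hnear'⟩ := hGV.exists_nearlyOrthogonalOn (hpos (n + 1))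
      (ε := (1 / 2) ^ (n + 1)) (by positivity)
      (max_lt (max_lt hρ1 hr1) (hrad (n + 1)))
    simp only [max_lt_iff] at hσ
    refine ⟨(G, V, σ), ⟨hGV, hσ.2.le, hσ1, hnear'⟩, hσ.1.1.le, fun z hz => ?_, fun z hz => ?_,
      hlow, N, hN, ?_, hderiv⟩
    · rw [dist_eq_norm, norm_sub_rev]
      exact (hclose z hz).1
    · rw [dist_eq_norm, norm_sub_rev]
      exact (hclose z hz).2
    · exact hr.trans (by gcongr; exact hσ.1.2)
  choose! step hgood hrefine using hstep
  obtain ⟨s₀, hs₀⟩ := hstart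
  let s : ℕ → (ℂ → E) × (ℂ → E) × ℝ := fun n => Nat.rec s₀ step n
  have hs : ∀ n, Good n (s n) := fun n => by
    induction n with
    | zero => exact hs₀
    | succ n ih => exact hgood n _ ih
  exact ⟨⟨fun n => (s n).1, fun n => (s n).2.2, fun n => (hs n).1.diff_left,
    fun n z hz => (hs n).1.norm_sq_le hz, fun n => (hs n).2.1, fun n => (hs n).2.2.1,
    fun n => hrefine n _ (hs n)⟩⟩

theorem dist_le_of_dist_succ_le_half_pow {X : Type*} [PseudoMetricSpace X] {f : ℕ → X} {a : X}
    {n : ℕ} (h : ∀ m ≥ n, dist (f m) (f (m + 1)) ≤ (1 / 2) ^ m) (ha : Tendsto f atTop (𝓝 a)) :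
    dist (f n) a ≤ 2 * (1 / 2) ^ n := by
  have := dist_le_of_le_geometric_of_tendsto₀ (1 / 2) ((1 / 2) ^ n) (f := fun j => f (j + n))
    (by norm_num) (fun j => ?_) ((tendsto_add_atTop_iff_nat n).2 ha)
  · rw [zero_add] at this
    exact this.trans_eq (by ring)
  · have h1 := h (j + n) (Nat.le_add_left n j)
    rw [pow_add, mul_comm] at h1
    rwa [Nat.add_right_comm]

namespace Approximation

variable (A : Approximation E) {F : ℂ → E}

theorem monotone_radius : Monotone A.radius :=
  monotone_nat_of_le_succ fun n => (A.isRefinement n).radius_le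

theorem exists_lt_radius {r : ℝ} (hr : r < 1) : ∃ m, r < A.radius m := by
  obtain ⟨m, hm⟩ := exists_nat_one_div_lt (sub_pos.2 hr)
  exact ⟨m, by linarith [A.le_radius m]⟩

/-- The maps of the approximation converge to `F` pointwise on the unit disc. -/
def ConvergesTo (F : ℂ → E) : Prop :=
  ∀ z ∈ ball (0 : ℂ) 1, Tendsto (fun n => A.map n z) atTop (𝓝 (F z))

theorem exists_convergesTo [CompleteSpace E] : ∃ F : ℂ → E, A.ConvergesTo F := by
  have : ∀ z, z ∈ ball (0 : ℂ) 1 → ∃ a, Tendsto (fun n => A.map n z) atTop (𝓝 a) := by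
    intro z hz
    obtain ⟨m, hm⟩ := A.exists_lt_radius (mem_ball_zero_iff.1 hz)
    have hC : CauchySeq fun j => A.map (j + m) z := by
      refine cauchySeq_of_le_geometric (1 / 2) ((1 / 2) ^ m) (by norm_num) fun j => ?_
      have h1 := (A.isRefinement (j + m)).dist_le z
        (hm.le.trans (A.monotone_radius (Nat.le_add_left m j)))
      rw [pow_add, mul_comm] at h1
      rwa [Nat.add_right_comm]
    obtain ⟨a, ha⟩ := cauchySeq_tendsto_of_complete hC
    exact ⟨a, (tendsto_add_atTop_iff_nat m).1 ha⟩
  choose! F hF using this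
  exact ⟨F, hF⟩

variable {A}

theorem norm_sq_limit_le (hF : A.ConvergesTo F) {z : ℂ} (hz : z ∈ ball (0 : ℂ) 1) : ‖F z‖ ^ 2 ≤ 3 / 4 :=
  le_of_tendsto' ((hF z hz).norm.pow 2) fun n =>
    (A.norm_sq_le n z (mem_ball_zero_iff.1 hz).le).trans (circleNormSq_lt n).le

theorem dist_le (hF : A.ConvergesTo F) {n : ℕ} {z : ℂ} (hz : ‖z‖ ≤ A.radius n) :
    dist (A.map n z) (F z) ≤ 2 * (1 / 2) ^ n :=
  dist_le_of_dist_succ_le_half_pow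
    (fun m hm => (A.isRefinement m).dist_le z (hz.trans (A.monotone_radius hm)))
    (hF z (mem_ball_zero_iff.2 (hz.trans_lt (A.radius_lt n))))

theorem sub_le_norm_sq_limit (hF : A.ConvergesTo F) {n : ℕ} {z : ℂ} (h₁ : A.radius n ≤ ‖z‖)
    (h₂ : ‖z‖ ≤ A.radius (n + 1)) : circleNormSq n - 5 * (1 / 2) ^ n ≤ ‖F z‖ ^ 2 := by
  have hz : ‖z‖ ≤ 1 := h₂.trans (A.radius_lt _).le
  have h3 := (A.isRefinement n).le_norm_sq z h₁ hz
  have h4 := dist_le hF h₂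
  have h5 := (A.norm_sq_le (n + 1) z hz).trans (circleNormSq_lt _).le
  have h6 : ‖A.map (n + 1) z‖ ≤ 1 := by nlinarith [norm_nonneg (A.map (n + 1) z)]
  have h7 := norm_sub_norm_le (A.map (n + 1) z) (F z)
  rw [dist_eq_norm, pow_succ] at h4
  have h8 : ‖A.map (n + 1) z‖ ≤ ‖F z‖ + (1 / 2) ^ n := by linarith
  have h9 : (0 : ℝ) ≤ (1 / 2) ^ n := by positivity
  rcases le_total ‖A.map (n + 1) z‖ ‖F z‖ with h | h <;>
    nlinarith [norm_nonneg (A.map (n + 1) z), norm_nonneg (F z)]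

theorem exists_lt_norm_sq_limit (hF : A.ConvergesTo F) {s : ℝ} (hs : s < 3 / 4) :
    ∃ r < 1, ∀ z ∈ ball (0 : ℂ) 1, r ≤ ‖z‖ → s < ‖F z‖ ^ 2 := by
  have ht : Tendsto (fun n : ℕ => circleNormSq n - 5 * (1 / 2) ^ n) atTop (𝓝 (3 / 4 - 5 * 0)) :=
    tendsto_circleNormSq.sub
      ((tendsto_pow_atTop_nhds_zero_of_lt_one (by norm_num) (by norm_num)).const_mul 5)
  obtain ⟨m, hm⟩ := eventually_atTop.1 (ht.eventually_const_lt (by simpa using hs))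
  refine ⟨A.radius m, A.radius_lt m, fun z hz hmz => ?_⟩
  obtain ⟨j, hj⟩ := A.exists_lt_radius (mem_ball_zero_iff.1 hz)
  obtain ⟨n, hmn, h1, h2⟩ : ∃ n ≥ m, A.radius n ≤ ‖z‖ ∧ ‖z‖ ≤ A.radius (n + 1) := by
    by_contra! hcon
    have : ∀ n ≥ m, A.radius n ≤ ‖z‖ := fun n hn => by
      induction n, hn using Nat.le_induction with
      | base => exact hmz
      | succ n hn ih => exact (hcon n hn ih).le
    exact absurd (this (max m j) (le_max_left m j))
      (not_le.2 (hj.trans_le (A.monotone_radius (le_max_right m j))))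
  exact (hm n hmn).trans_le (sub_le_norm_sq_limit hF h1 h2)

theorem tendstoLocallyUniformlyOn (hF : A.ConvergesTo F) : TendstoLocallyUniformlyOn A.map F atTop (ball 0 1) := by
  rw [Metric.tendstoLocallyUniformlyOn_iff]
  intro ε hε x hx
  obtain ⟨m, hm⟩ := A.exists_lt_radius (mem_ball_zero_iff.1 hx)
  refine ⟨ball 0 (A.radius m), mem_nhdsWithin_of_mem_nhds
    (isOpen_ball.mem_nhds (mem_ball_zero_iff.2 hm)), ?_⟩
  have ht : Tendsto (fun n : ℕ => 2 * (1 / 2 : ℝ) ^ n) atTop (𝓝 (2 * 0)) :=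
    (tendsto_pow_atTop_nhds_zero_of_lt_one (by norm_num) (by norm_num)).const_mul 2
  filter_upwards [ht.eventually_lt_const (by simpa using hε), eventually_ge_atTop m]
    with n hn hmn y hy
  rw [dist_comm]
  exact (dist_le hF ((mem_ball_zero_iff.1 hy).le.trans (A.monotone_radius hmn))).trans_lt hn

variable [CompleteSpace E]

theorem differentiableOn (hF : A.ConvergesTo F) : DifferentiableOn ℂ F (ball 0 1) :=
  (tendstoLocallyUniformlyOn hF).differentiableOn
    (Eventually.of_forall fun n => (A.differentiable n).differentiableOn) isOpen_ball

theorem dist_deriv_le (hF : A.ConvergesTo F) {n : ℕ} {z : ℂ} (hz : ‖z‖ ≤ A.radius n) :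
    dist (deriv (A.map n) z) (deriv F z) ≤ 2 * (1 / 2) ^ n :=
  dist_le_of_dist_succ_le_half_pow (f := fun n => deriv (A.map n) z)
    (fun m hm => (A.isRefinement m).dist_deriv_le z (hz.trans (A.monotone_radius hm)))
    (((tendstoLocallyUniformlyOn hF).deriv
      (Eventually.of_forall fun n => (A.differentiable n).differentiableOn) isOpen_ball).tendsto_at
        (mem_ball_zero_iff.2 (hz.trans_lt (A.radius_lt n))))

theorem le_eVariationOn_limit (hF : A.ConvergesTo F) {n : ℕ} {γ : ℝ → ℂ} {s t : ℝ} (hst : s ≤ t)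
    (hγ : ContinuousOn γ (Icc s t)) (hγ₁ : MapsTo γ (Icc s t) (ball 0 1))
    (hs : ‖γ s‖ ≤ A.radius n) (ht : A.radius (n + 1) ≤ ‖γ t‖) :
    ENNReal.ofReal (1 / 8 * (1 / (n + 3))) ≤ eVariationOn (F ∘ γ) (Icc s t) := by
  obtain ⟨N, hN1, hN2, hN⟩ := (A.isRefinement n).exists_le_norm_deriv
  have hκ := one_div_le_sqrt_circleNormSq_succ_sub n
  set k : ℝ := √(circleNormSq (n + 1) - circleNormSq n) / 4 with hk
  have hn : (0 : ℝ) < 1 / (n + 3) := by positivity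
  have hk0 : 0 < k := by linarith
  have hnorm : ∀ z : ℂ, ‖(k : ℂ) * z ^ (N + 1)‖ = k * ‖z‖ ^ (N + 1) := fun z => by
    rw [norm_mul, norm_pow, Complex.norm_real, Real.norm_of_nonneg hk0.le]
  have hrad : ∀ n, 0 ≤ A.radius n := fun n =>
    le_trans (by simp) ((A.le_radius 0).trans (A.monotone_radius n.zero_le))
  refine le_trans (ENNReal.ofReal_le_ofReal ?_)
    (ofReal_sub_le_eVariationOn_comp (g := fun z => (k : ℂ) * z ^ (N + 1)) (a := k * (1 / 4))
      (b := k * (3 / 4)) (by linarith) isOpen_ball (differentiableOn hF) (by fun_prop) ?_ hst hγ hγ₁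
      ?_ ?_)
  · linarith
  · intro z hz h1 h2
    rw [hnorm, mul_le_mul_iff_right₀ hk0] at h1 h2
    have hz1 : ‖z‖ ≤ A.radius (n + 1) :=
      (lt_of_pow_lt_pow_left₀ _ (hrad _) (h2.trans_lt hN2)).le
    have h3 := hN z (mem_ball_zero_iff.1 hz).le h1
    have h4 := dist_deriv_le hF hz1
    have h5 := norm_sub_norm_le (deriv (A.map (n + 1)) z) (deriv F z)
    have h6 : (1 / 2 : ℝ) ^ n ≤ 1 := pow_le_one₀ (by norm_num) (by norm_num)
    have h7 : deriv (fun z => (k : ℂ) * z ^ (N + 1)) z = k * ((N + 1 : ℝ) * z ^ N) := by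
      simp
    rw [dist_eq_norm, pow_succ] at h4
    rw [h7, norm_mul, norm_mul, norm_pow, Complex.norm_real, Complex.norm_real,
      Real.norm_of_nonneg hk0.le, Real.norm_of_nonneg (by positivity)]
    linarith
  · rw [hnorm]
    gcongr
    exact (pow_le_pow_left₀ (norm_nonneg _) hs _).trans hN1.le
  · rw [hnorm]
    gcongr
    exact hN2.le.trans (pow_le_pow_left₀ (hrad _) ht _)

theorem sum_le_eVariationOn_limit (hF : A.ConvergesTo F) {m : ℕ} {γ : ℝ → ℂ} {s : ℝ} (hs : ‖γ s‖ ≤ A.radius m) (j : ℕ)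
    {t : ℝ} (hst : s ≤ t) (hγ : ContinuousOn γ (Icc s t)) (hγ₁ : MapsTo γ (Icc s t) (ball 0 1))
    (ht : A.radius (m + j) ≤ ‖γ t‖) :
    ENNReal.ofReal (∑ i ∈ Finset.range j, 1 / 8 * (1 / ((m + i : ℕ) + 3 : ℝ))) ≤
      eVariationOn (F ∘ γ) (Icc s t) := by
  induction j generalizing t with
  | zero => simp
  | succ j ih =>
    have hmono := A.monotone_radius
    obtain ⟨u, ⟨hsu, hut⟩, hu⟩ := intermediate_value_Icc hst hγ.norm
      ⟨hs.trans (hmono (Nat.le_add_right m j)), (hmono (m + j).le_succ).trans ht⟩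
    dsimp only at hu
    rw [Finset.sum_range_succ, ENNReal.ofReal_add (by positivity) (by positivity)]
    have hadd := eVariationOn.Icc_add_Icc (F ∘ γ) (s := univ) hsu hut trivial
    simp only [univ_inter] at hadd
    rw [← hadd]
    gcongr
    · exact ih hsu (hγ.mono (Icc_subset_Icc_right hut))
        (hγ₁.mono_left (Icc_subset_Icc_right hut)) hu.ge
    · exact le_eVariationOn_limit hF hut (hγ.mono (Icc_subset_Icc_left hsu))
        (hγ₁.mono_left (Icc_subset_Icc_left hsu)) hu.le ht

theorem eVariationOn_limit_eq_top (hF : A.ConvergesTo F) {γ : ℝ → ℂ} (hγ : DivergentPathIn (ball 0 1) γ) :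
    eVariationOn (F ∘ γ) (Ico 0 1) = ⊤ := by
  obtain ⟨hcont, hmem, hdiv⟩ := hγ
  obtain ⟨m, hm⟩ := A.exists_lt_radius (mem_ball_zero_iff.1 (hmem 0 (by simp)))
  have hsum : Tendsto (fun j => ∑ i ∈ Finset.range j, 1 / 8 * (1 / ((m + i : ℕ) + 3 : ℝ)))
      atTop atTop := by
    refine (not_summable_iff_tendsto_nat_atTop_of_nonneg fun i => by positivity).1 fun h => ?_
    refine Real.not_summable_one_div_natCast ((summable_nat_add_iff (m + 3)).1
      ((h.mul_left 8).congr fun i => ?_))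
    push_cast
    field_simp
    ring
  refine top_le_iff.1 (le_of_tendsto' (ENNReal.tendsto_ofReal_atTop.comp hsum) fun j => ?_)
  obtain ⟨t, ht, hout⟩ := hdiv (closedBall 0 (A.radius (m + j)))
    (closedBall_subset_ball (A.radius_lt _)) (isCompact_closedBall _ _)
  have hIcc : Icc 0 t ⊆ Ico 0 1 := Icc_subset_Ico_right ht.2
  have hfar := hout t ⟨le_rfl, ht.2⟩
  rw [mem_closedBall_zero_iff, not_le] at hfar
  exact (sum_le_eVariationOn_limit hF hm.le j ht.1 (hcont.mono hIcc)
    (fun u hu => hmem u (hIcc hu)) hfar.le).trans (eVariationOn.mono _ hIcc)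

end Approximation

end Approximation

/-- A map into `ℂ²` followed in `ℂ⁴` by the parameter of the disc and a zero coordinate. -/
def adjoinParameter (F : ℂ → EuclideanSpace ℂ (Fin 2)) (z : ℂ) : EuclideanSpace ℂ (Fin 4) :=
  !₂[F z 0, F z 1, z / 2, 0]

section AdjoinParameter

variable {F : ℂ → EuclideanSpace ℂ (Fin 2)}

theorem norm_sq_adjoinParameter (z : ℂ) :
    ‖adjoinParameter F z‖ ^ 2 = ‖F z‖ ^ 2 + ‖z‖ ^ 2 / 4 := by
  simp only [adjoinParameter, EuclideanSpace.norm_sq_eq, Fin.sum_univ_four, Fin.sum_univ_two]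
  simp
  ring

theorem edist_le_edist_adjoinParameter (z w : ℂ) :
    edist (F z) (F w) ≤ edist (adjoinParameter F z) (adjoinParameter F w) := by
  rw [edist_dist, edist_dist, dist_eq_norm, dist_eq_norm]
  refine ENNReal.ofReal_le_ofReal ?_
  refine (sq_le_sq₀ (norm_nonneg _) (norm_nonneg _)).1 ?_
  simp only [adjoinParameter, EuclideanSpace.norm_sq_eq, Fin.sum_univ_four, Fin.sum_univ_two]
  simp

theorem DifferentiableOn.adjoinParameter {s : Set ℂ} (hF : DifferentiableOn ℂ F s) :
    DifferentiableOn ℂ (adjoinParameter F) s := by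
  rw [differentiableOn_euclidean] at hF ⊢
  intro i
  fin_cases i
  · exact hF 0
  · exact hF 1
  · exact differentiableOn_id.div_const 2
  · exact differentiableOn_const 0

theorem injective_adjoinParameter : Function.Injective (adjoinParameter F) := by
  intro z w h
  have h2 := congrArg (fun v : EuclideanSpace ℂ (Fin 4) => v 2) h
  simpa [adjoinParameter] using h2

theorem deriv_adjoinParameter_ne_zero {z : ℂ} (hF : DifferentiableAt ℂ (adjoinParameter F) z) :
    deriv (adjoinParameter F) z ≠ 0 := by
  intro h0
  have h1 := (EuclideanSpace.proj (𝕜 := ℂ) (2 : Fin 4)).hasFDerivAt.comp_hasDerivAt z hF.hasDerivAt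
  have h2 : HasDerivAt (fun w : ℂ => w / 2) (1 / 2) z := (hasDerivAt_id z).div_const 2
  have h3 := h1.unique h2
  simp [h0] at h3

end AdjoinParameter

/-- Jones: a complete properly embedded complex disc in the unit ball 𝔹₄ of ℂ⁴. -/
theorem jones_complete_proper_embedded_disc_B4 :
    ∃ φ : ℂ → EuclideanSpace ℂ (Fin 4),
      DifferentiableOn ℂ φ (Metric.ball (0 : ℂ) 1) ∧
      Set.InjOn φ (Metric.ball (0 : ℂ) 1) ∧
      (∀ ζ ∈ Metric.ball (0 : ℂ) 1, deriv φ ζ ≠ 0) ∧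
      (∀ ζ ∈ Metric.ball (0 : ℂ) 1, φ ζ ∈ Metric.ball (0 : EuclideanSpace ℂ (Fin 4)) 1) ∧
      (∀ K : Set (EuclideanSpace ℂ (Fin 4)),
        K ⊆ Metric.ball (0 : EuclideanSpace ℂ (Fin 4)) 1 → IsCompact K →
        IsCompact {ζ ∈ Metric.ball (0 : ℂ) 1 | φ ζ ∈ K}) ∧
      (∀ γ : ℝ → ℂ, DivergentPathIn (Metric.ball (0 : ℂ) 1) γ →
        eVariationOn (fun t => φ (γ t)) (Set.Ico 0 1) = ⊤) := by
  obtain ⟨A⟩ := nonempty_approximation (e₁ := EuclideanSpace.single (0 : Fin 2) (1 : ℂ))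
    (e₂ := EuclideanSpace.single (1 : Fin 2) (1 : ℂ)) (by simp) (by simp)
    (by simp [EuclideanSpace.inner_single_left])
  obtain ⟨F, hF⟩ := A.exists_convergesTo
  have hdiff := (Approximation.differentiableOn hF).adjoinParameter
  refine ⟨adjoinParameter F, hdiff, injective_adjoinParameter.injOn,
    fun z hz => deriv_adjoinParameter_ne_zero (hdiff.differentiableAt (isOpen_ball.mem_nhds hz)),
    fun z hz => ?_, fun K hK hKc => ?_, fun γ hγ => ?_⟩
  · have h1 := Approximation.norm_sq_limit_le hF hz
    rw [mem_ball_zero_iff] at hz ⊢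
    rw [← sq_lt_one_iff₀ (norm_nonneg _), norm_sq_adjoinParameter]
    nlinarith [norm_nonneg z]
  · obtain ⟨s, ⟨hs0, hs1⟩, hKs⟩ := exists_pos_lt_subset_ball one_pos hKc.isClosed hK
    have hs2 : s ^ 2 < 1 := (sq_lt_one_iff₀ hs0.le).2 hs1
    obtain ⟨r, hr, hFr⟩ := Approximation.exists_lt_norm_sq_limit hF
      (s := 3 / 4 - (1 - s ^ 2) / 2) (by linarith)
    have hρ : max r (s ^ 2) < 1 := max_lt hr hs2
    have hclosed : IsClosed (closedBall 0 (max r (s ^ 2)) ∩ adjoinParameter F ⁻¹' K) :=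
      (hdiff.continuousOn.mono (closedBall_subset_ball hρ)).preimage_isClosed_of_isClosed
        isClosed_closedBall hKc.isClosed
    convert (isCompact_closedBall (0 : ℂ) (max r (s ^ 2))).of_isClosed_subset hclosed
      inter_subset_left using 1
    ext z
    refine ⟨fun ⟨hz, hzK⟩ => ⟨?_, hzK⟩, fun ⟨hz, hzK⟩ => ⟨closedBall_subset_ball hρ hz, hzK⟩⟩
    by_contra! hfar
    rw [mem_closedBall_zero_iff, not_le, max_lt_iff] at hfar
    have h1 := hFr z hz hfar.1.le
    have h2 : ‖adjoinParameter F z‖ ^ 2 < s ^ 2 :=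
      pow_lt_pow_left₀ (mem_ball_zero_iff.1 (hKs hzK)) (norm_nonneg _) two_ne_zero
    rw [norm_sq_adjoinParameter] at h2
    nlinarith [hfar.2, sq_nonneg s]
  · rw [← top_le_iff, ← Approximation.eVariationOn_limit_eq_top hF hγ]
    exact iSup_mono fun p => Finset.sum_le_sum fun i _ => edist_le_edist_adjoinParameter _ _
end
end
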